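/- arXiv:1608.01016 — 3 statements merged into one kernel-verified Lean document; each statement's English description precedes it below -/
import Mathlib

section
/- Let (X_t) be the conditioned walk on the positive integers started at x ≥ 1. Then the total number of visits to x, namely #{t ≥ 0 : X_t = x}, is geometrically distributed with success probability 1/(2x): for every integer j ≥ 1, P̂_x[#{t ≥ 0 : X_t = x} = j] = (1/(2x)) (1 − 1/(2x))^{j−1}. -/
open MeasureTheory ProbabilityTheory Finset
open scoped ENNReal

/-- One step transition probability of the simple random walk on the positive
integers conditioned to never hit the origin:
`P(x, x+1) = (x+1)/(2x)` and `P(x, x-1) = (x-1)/(2x)`. -/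
noncomputable def condStep (u v : ℤ) : ℝ≥0∞ :=
  ENNReal.ofReal
    (if v = u + 1 then ((u : ℝ) + 1) / (2 * u)
      else if v = u - 1 then ((u : ℝ) - 1) / (2 * u) else 0)

/-- `Pr` is the law of the conditioned walk `X` (the walk on the positive
integers with transition probabilities `condStep`) started at `x`. -/
def IsCondWalk {Ω : Type*} [MeasurableSpace Ω] (Pr : Measure Ω) (X : ℕ → Ω → ℤ)
    (x : ℤ) : Prop :=
  IsProbabilityMeasure Pr ∧ (∀ t, Measurable (X t)) ∧
    ∀ (t : ℕ) (γ : ℕ → ℤ), γ 0 = x →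
      Pr {ω | ∀ s ≤ t, X s ω = γ s} = ∏ s ∈ Finset.range t, condStep (γ s) (γ (s + 1))

namespace IsCondWalk

variable {Ω : Type*} [MeasurableSpace Ω] {Pr : Measure Ω} {X : ℕ → Ω → ℤ} {x : ℤ}

lemma ae_start (h : IsCondWalk Pr X x) : ∀ᵐ ω ∂Pr, X 0 ω = x := by
  have := h.1
  have h0 := h.2.2 0 (fun _ => x) rfl
  simp only [nonpos_iff_eq_zero, forall_eq, Finset.range_zero, Finset.prod_empty] at h0
  exact (prob_compl_eq_zero_iff (h.2.1 0 (measurableSet_singleton x))).2 h0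

/-- The Markov property at time `t`, for a single history. -/
lemma measure_history_next (h : IsCondWalk Pr X x) (t : ℕ) (γ : Fin (t + 1) → ℤ) (v : ℤ) :
    Pr {ω | (∀ i : Fin (t + 1), X i ω = γ i) ∧ X (t + 1) ω = v}
      = Pr {ω | ∀ i : Fin (t + 1), X i ω = γ i} * condStep (γ (Fin.last t)) v := by
  by_cases hγ : γ 0 = x
  · set δ : ℕ → ℤ := fun s => if hs : s < t + 1 then γ ⟨s, hs⟩ else v with hδ
    have hδ0 : δ 0 = x := by simpa [hδ] using hγ
    have e1 : {ω | (∀ i : Fin (t + 1), X i ω = γ i) ∧ X (t + 1) ω = v}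
        = {ω | ∀ s ≤ t + 1, X s ω = δ s} := by
      ext ω
      constructor
      · rintro ⟨h1, h2⟩ s hs
        rcases Nat.lt_or_ge s (t + 1) with h' | h'
        · simpa only [hδ, dif_pos h'] using h1 ⟨s, h'⟩
        · obtain rfl : s = t + 1 := le_antisymm hs h'
          simpa [hδ] using h2
      · intro h1
        refine ⟨fun i => ?_, ?_⟩
        · simpa only [hδ, dif_pos i.2] using h1 i i.2.le
        · simpa [hδ] using h1 (t + 1) le_rfl
    have e2 : {ω | ∀ i : Fin (t + 1), X i ω = γ i} = {ω | ∀ s ≤ t, X s ω = δ s} := by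
      ext ω
      constructor
      · intro h1 s hs
        have h' : s < t + 1 := Nat.lt_succ_of_le hs
        simpa only [hδ, dif_pos h'] using h1 ⟨s, h'⟩
      · intro h1 i
        simpa only [hδ, dif_pos i.2] using h1 i (Nat.le_of_lt_succ i.2)
    rw [e1, e2, h.2.2 _ δ hδ0, h.2.2 _ δ hδ0, Finset.prod_range_succ]
    simp [hδ, Fin.last]
  · have hz : Pr {ω | ∀ i : Fin (t + 1), X i ω = γ i} = 0 := by
      refine measure_mono_null (fun ω hω (hω' : X 0 ω = x) => hγ ?_) (ae_iff.1 h.ae_start)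
      exact (hω 0).symm.trans hω'
    rw [hz, zero_mul]
    exact measure_mono_null (fun ω hω => hω.1) hz

/-- The Markov property at time `t`, for functionals of the history and of the next state. -/
lemma lintegral_history_next (h : IsCondWalk Pr X x) (t : ℕ)
    (G : (Fin (t + 1) → ℤ) → ℤ → ℝ≥0∞) :
    ∫⁻ ω, G (fun i => X i ω) (X (t + 1) ω) ∂Pr
      = ∫⁻ ω, (G (fun i => X i ω) (X t ω + 1) * condStep (X t ω) (X t ω + 1)
        + G (fun i => X i ω) (X t ω - 1) * condStep (X t ω) (X t ω - 1)) ∂Pr := by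
  have hH : Measurable fun ω (i : Fin (t + 1)) => X i ω := measurable_pi_lambda _ fun i => h.2.1 i
  have hHX : Measurable fun ω => ((fun i : Fin (t + 1) => X i ω), X (t + 1) ω) :=
    hH.prodMk (h.2.1 (t + 1))
  have e1 := lintegral_map (μ := Pr) (f := fun p : (Fin (t + 1) → ℤ) × ℤ => G p.1 p.2)
    Measurable.of_discrete hHX
  have e2 := lintegral_map (μ := Pr) (f := fun γ : Fin (t + 1) → ℤ =>
    (G γ (γ (Fin.last t) + 1) * condStep (γ (Fin.last t)) (γ (Fin.last t) + 1)
      + G γ (γ (Fin.last t) - 1) * condStep (γ (Fin.last t)) (γ (Fin.last t) - 1)))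
    Measurable.of_discrete hH
  simp only [Fin.val_last] at e2
  rw [← e1, ← e2, lintegral_countable', lintegral_countable', ENNReal.tsum_prod']
  refine tsum_congr fun γ => ?_
  rw [Measure.map_apply hH (measurableSet_singleton γ)]
  have key (v : ℤ) : Measure.map (fun ω => ((fun i : Fin (t + 1) => X i ω), X (t + 1) ω)) Pr
      {(γ, v)} = Pr ((fun ω (i : Fin (t + 1)) => X i ω) ⁻¹' {γ}) * condStep (γ (Fin.last t)) v := by
    rw [Measure.map_apply hHX (measurableSet_singleton _)]
    convert h.measure_history_next t γ v using 2
    · ext ω; simp [funext_iff]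
    · congr 1; ext ω; simp [funext_iff]
  simp only [key]
  rw [tsum_eq_sum (s := {γ (Fin.last t) + 1, γ (Fin.last t) - 1}), Finset.sum_pair (by lia)]
  · ring
  · intro v hv
    simp only [Finset.mem_insert, Finset.mem_singleton, not_or] at hv
    simp [condStep, hv.1, hv.2]

lemma lintegral_next (h : IsCondWalk Pr X x) (t : ℕ) (g : ℤ → ℝ≥0∞) :
    ∫⁻ ω, g (X (t + 1) ω) ∂Pr
      = ∫⁻ ω, (g (X t ω + 1) * condStep (X t ω) (X t ω + 1)
        + g (X t ω - 1) * condStep (X t ω) (X t ω - 1)) ∂Pr :=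
  h.lintegral_history_next t fun _ => g

lemma ae_pos (h : IsCondWalk Pr X x) (hx : 1 ≤ x) (t : ℕ) : ∀ᵐ ω ∂Pr, 1 ≤ X t ω := by
  induction t with
  | zero => filter_upwards [h.ae_start] with ω hω using hω ▸ hx
  | succ t ih =>
    have h1 := h.lintegral_next t fun v => if 1 ≤ v then 0 else 1
    rw [lintegral_eq_zero_of_ae_eq_zero (f := fun ω => _ + _), lintegral_eq_zero_iff] at h1
    · filter_upwards [h1] with ω hω
      by_contra hc
      simp [hc] at hω
    · exact (Measurable.of_discrete (f := fun v : ℤ => if 1 ≤ v then (0 : ℝ≥0∞) else 1)).comp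
        (h.2.1 (t + 1))
    · filter_upwards [ih] with ω hω
      rcases hω.eq_or_lt with h1 | h1
      · simp [← h1, condStep]
      · rw [if_pos (by lia), if_pos (by lia)]
        simp

end IsCondWalk

lemma condStep_add_one (u : ℤ) :
    condStep u (u + 1) = ENNReal.ofReal (((u : ℝ) + 1) / (2 * u)) := by
  simp [condStep]

lemma condStep_sub_one (u : ℤ) :
    condStep u (u - 1) = ENNReal.ofReal (((u : ℝ) - 1) / (2 * u)) := by
  rw [condStep, if_neg (by lia), if_pos rfl]

lemma ofReal_condStep_average {u : ℤ} (hu : 1 ≤ u) {a b : ℝ} (ha : 0 ≤ a) (hb : 0 ≤ b) :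
    ENNReal.ofReal a * condStep u (u + 1) + ENNReal.ofReal b * condStep u (u - 1)
      = ENNReal.ofReal (a * (((u : ℝ) + 1) / (2 * u)) + b * (((u : ℝ) - 1) / (2 * u))) := by
  have hu' : (1 : ℝ) ≤ u := by exact_mod_cast hu
  have h1 : (0 : ℝ) ≤ ((u : ℝ) - 1) / (2 * u) := div_nonneg (by linarith) (by linarith)
  rw [condStep_add_one, condStep_sub_one, ← ENNReal.ofReal_mul ha, ← ENNReal.ofReal_mul hb,
    ← ENNReal.ofReal_add (by positivity) (by positivity)]

namespace IsCondWalk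

variable {Ω : Type*} [MeasurableSpace Ω] {Pr : Measure Ω} {X : ℕ → Ω → ℤ} {x : ℤ}

/-- The decrement of `E[1 / X_t]` is `P[X_t = 1] / 2`. -/
lemma lintegral_inv_next (h : IsCondWalk Pr X x) (hx : 1 ≤ x) (t : ℕ) :
    ∫⁻ ω, ENNReal.ofReal (X (t + 1) ω : ℝ)⁻¹ ∂Pr + ENNReal.ofReal (1 / 2) * Pr {ω | X t ω = 1}
      = ∫⁻ ω, ENNReal.ofReal (X t ω : ℝ)⁻¹ ∂Pr := by
  have hm : MeasurableSet {ω | X t ω = 1} := h.2.1 t (measurableSet_singleton 1)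
  rw [h.lintegral_next t fun v => ENNReal.ofReal (v : ℝ)⁻¹, ← lintegral_indicator_const hm,
    ← lintegral_add_right _ (measurable_const.indicator hm)]
  refine lintegral_congr_ae ?_
  filter_upwards [h.ae_pos hx t] with ω hω
  have hu : (1 : ℝ) ≤ X t ω := by exact_mod_cast hω
  have hu0 : (0 : ℝ) ≤ ((X t ω - 1 : ℤ) : ℝ)⁻¹ := inv_nonneg.2 (by push_cast; linarith)
  have hu1 : (0 : ℝ) ≤ ((X t ω + 1 : ℤ) : ℝ)⁻¹ := inv_nonneg.2 (by push_cast; linarith)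
  rw [ofReal_condStep_average hω hu1 hu0]
  push_cast
  by_cases h1 : X t ω = 1
  · rw [Set.indicator_of_mem (by exact h1), ← ENNReal.ofReal_add (by simp [h1]) (by norm_num)]
    norm_num [h1]
  · have h2 : (X t ω : ℝ) - 1 ≠ 0 := sub_ne_zero.2 (by exact_mod_cast h1)
    rw [Set.indicator_of_notMem (by exact h1), add_zero]
    congr 1
    field_simp
    ring

lemma tendsto_measure_eq_one (h : IsCondWalk Pr X x) (hx : 1 ≤ x) :
    Filter.Tendsto (fun t => Pr {ω | X t ω = 1}) Filter.atTop (nhds 0) := by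
  have := h.1
  set a : ℕ → ℝ≥0∞ := fun t => ∫⁻ ω, ENNReal.ofReal (X t ω : ℝ)⁻¹ ∂Pr with ha
  have hsum (n : ℕ) : a n + ∑ t ∈ range n, ENNReal.ofReal (1 / 2) * Pr {ω | X t ω = 1} = a 0 := by
    induction n with
    | zero => simp
    | succ n ih =>
      rw [Finset.sum_range_succ, ← ih]
      simp only [ha]
      rw [← h.lintegral_inv_next hx n]
      ring
  have ha0 : a 0 ≤ 1 := by
    calc a 0 ≤ ∫⁻ _, 1 ∂Pr := by
          refine lintegral_mono_ae ?_
          filter_upwards [h.ae_pos hx 0] with ω hω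
          have : (1 : ℝ) ≤ X 0 ω := by exact_mod_cast hω
          exact ENNReal.ofReal_le_one.2 (inv_le_one_of_one_le₀ this)
      _ = 1 := by simp
  have hle : ∑' t, ENNReal.ofReal (1 / 2) * Pr {ω | X t ω = 1} ≤ 1 := by
    rw [ENNReal.tsum_eq_iSup_nat]
    exact iSup_le fun n => le_add_self.trans ((hsum n).le.trans ha0)
  have hfin : ∑' t, Pr {ω | X t ω = 1} ≠ ∞ := by
    intro htop
    rw [ENNReal.tsum_mul_left, htop, ENNReal.mul_top (by simp)] at hle
    simp at hle
  have := ENNReal.tendsto_cofinite_zero_of_tsum_ne_top hfin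
  rwa [Nat.cofinite_eq_atTop] at this

lemma measure_eq_add_one_le (h : IsCondWalk Pr X x) (t : ℕ) (v : ℤ) :
    condStep (v + 1) v * Pr {ω | X t ω = v + 1} ≤ Pr {ω | X (t + 1) ω = v} := by
  have hm (s : ℕ) (u : ℤ) : MeasurableSet {ω | X s ω = u} := h.2.1 s (measurableSet_singleton u)
  have h1 := h.lintegral_next t fun u => if u = v then 1 else 0
  have h2 : ∫⁻ ω, (if X (t + 1) ω = v then (1 : ℝ≥0∞) else 0) ∂Pr = Pr {ω | X (t + 1) ω = v} := by
    rw [← lintegral_indicator_one (hm (t + 1) v)]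
    simp [Set.indicator_apply]
  rw [← h2, h1, ← lintegral_indicator_const (hm t (v + 1))]
  refine lintegral_mono fun ω => ?_
  by_cases hω : X t ω = v + 1 <;> simp [hω]

lemma tendsto_measure_eq (h : IsCondWalk Pr X x) (hx : 1 ≤ x) {v : ℤ} (hv : 1 ≤ v) :
    Filter.Tendsto (fun t => Pr {ω | X t ω = v}) Filter.atTop (nhds 0) := by
  induction v, hv using Int.leInduction with
  | base => exact h.tendsto_measure_eq_one hx
  | succ v hv ih =>
    have hv' : (1 : ℝ) ≤ v := by exact_mod_cast hv
    have hc : condStep (v + 1) v ≠ 0 := by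
      have := condStep_sub_one (v + 1)
      rw [add_sub_cancel_right] at this
      rw [this]
      refine (ENNReal.ofReal_pos.2 ?_).ne'
      push_cast
      exact div_pos (by linarith) (by linarith)
    have hc' : condStep (v + 1) v ≠ ∞ := ENNReal.ofReal_ne_top
    have h1 : Filter.Tendsto (fun t => (condStep (v + 1) v)⁻¹ * Pr {ω | X (t + 1) ω = v})
        Filter.atTop (nhds 0) := by
      have := ENNReal.Tendsto.const_mul (a := (condStep (v + 1) v)⁻¹)
        ((Filter.tendsto_add_atTop_iff_nat 1).2 ih) (Or.inr (ENNReal.inv_ne_top.2 hc))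
      simpa using this
    refine tendsto_of_tendsto_of_tendsto_of_le_of_le tendsto_const_nhds h1 (fun _ => zero_le)
      fun t => ?_
    calc Pr {ω | X t ω = v + 1}
        = (condStep (v + 1) v)⁻¹ * (condStep (v + 1) v * Pr {ω | X t ω = v + 1}) := by
          rw [← mul_assoc, ENNReal.inv_mul_cancel hc hc', one_mul]
      _ ≤ _ := by gcongr; exact h.measure_eq_add_one_le t v

/-- A bounded function vanishing at infinity has vanishing expectation along the walk. -/
lemma tendsto_lintegral_zero (h : IsCondWalk Pr X x) (hx : 1 ≤ x) {g : ℤ → ℝ≥0∞}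
    (hg : ∀ v, g v ≤ 1) (hg0 : Filter.Tendsto g Filter.atTop (nhds 0)) :
    Filter.Tendsto (fun t => ∫⁻ ω, g (X t ω) ∂Pr) Filter.atTop (nhds 0) := by
  have := h.1
  have hm (s : ℕ) (u : ℤ) : MeasurableSet {ω | X s ω = u} := h.2.1 s (measurableSet_singleton u)
  refine ENNReal.tendsto_nhds_zero.2 fun ε hε => ?_
  have hε2 : 0 < ε / 2 := ENNReal.half_pos hε.ne'
  obtain ⟨K, hK⟩ := Filter.eventually_atTop.1 (ENNReal.tendsto_nhds_zero.1 hg0 (ε / 2) hε2)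
  have hS : Filter.Tendsto (fun t => ∑ v ∈ Finset.Ico 1 K, Pr {ω | X t ω = v}) Filter.atTop
      (nhds 0) := by
    simpa using tendsto_finsetSum (Finset.Ico 1 K) fun v hv =>
      h.tendsto_measure_eq hx (Finset.mem_Ico.1 hv).1
  filter_upwards [ENNReal.tendsto_nhds_zero.1 hS (ε / 2) hε2] with t ht
  calc ∫⁻ ω, g (X t ω) ∂Pr
      ≤ ∫⁻ ω, (∑ v ∈ Finset.Ico 1 K, {ω | X t ω = v}.indicator 1 ω + ε / 2) ∂Pr := by
        refine lintegral_mono_ae ?_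
        filter_upwards [h.ae_pos hx t] with ω hω
        rcases lt_or_ge (X t ω) K with hlt | hge
        · refine le_add_right ((hg _).trans ?_)
          refine le_trans ?_ (Finset.single_le_sum (fun _ _ => zero_le)
            (Finset.mem_Ico.2 ⟨hω, hlt⟩))
          simp
        · exact le_add_left (hK _ hge)
    _ = ∑ v ∈ Finset.Ico 1 K, Pr {ω | X t ω = v} + ε / 2 := by
        rw [lintegral_add_right _ measurable_const, lintegral_finsetSum]
        · simp [lintegral_indicator_one (hm t _)]
        · exact fun v _ => measurable_one.indicator (hm t v)
    _ ≤ ε := (add_le_add_left ht _).trans (ENNReal.add_halves ε).le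

end IsCondWalk

/-- The probability that the conditioned walk started at `v` visits `x` at some time `t ≥ 0`. -/
noncomputable def hitProb (x v : ℤ) : ℝ := if v ≤ x then 1 else (x : ℝ) / v

/-- The probability that the conditioned walk started at `v` visits `x` at some time `t ≥ 1`. -/
noncomputable def returnProb (x v : ℤ) : ℝ := if v = x then 1 - 1 / (2 * (x : ℝ)) else hitProb x v

/-- The conditional probability that `x` is visited `j` times in total, given that it has been
visited `k` times so far and that a further visit has probability `r`. -/
noncomputable def visitsProb (x : ℤ) (j k : ℕ) (r : ℝ) : ℝ :=
  if k = j then 1 - r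
  else if k < j then r * (1 / (2 * (x : ℝ)) * (1 - 1 / (2 * (x : ℝ))) ^ (j - k - 1)) else 0

section HittingProbabilities

variable {x : ℤ}

lemma hitProb_nonneg (hx : 1 ≤ x) (v : ℤ) : 0 ≤ hitProb x v := by
  have hx' : (1 : ℝ) ≤ x := by exact_mod_cast hx
  unfold hitProb
  split_ifs with hv
  · exact zero_le_one
  · have : (x : ℝ) < v := by exact_mod_cast not_le.1 hv
    exact div_nonneg (by linarith) (by linarith)

lemma hitProb_le_one (hx : 1 ≤ x) (v : ℤ) : hitProb x v ≤ 1 := by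
  have hx' : (1 : ℝ) ≤ x := by exact_mod_cast hx
  unfold hitProb
  split_ifs with hv
  · exact le_rfl
  · have : (x : ℝ) < v := by exact_mod_cast not_le.1 hv
    exact (div_le_one (by linarith)).2 this.le

lemma escapeProb_mem (hx : 1 ≤ x) : 0 ≤ 1 / (2 * (x : ℝ)) ∧ 1 / (2 * (x : ℝ)) ≤ 1 := by
  have hx' : (1 : ℝ) ≤ x := by exact_mod_cast hx
  exact ⟨by positivity, (div_le_one (by linarith)).2 (by linarith)⟩

lemma returnProb_nonneg (hx : 1 ≤ x) (v : ℤ) : 0 ≤ returnProb x v := by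
  unfold returnProb
  split_ifs
  · linarith [escapeProb_mem hx]
  · exact hitProb_nonneg hx v

lemma returnProb_le_one (hx : 1 ≤ x) (v : ℤ) : returnProb x v ≤ 1 := by
  unfold returnProb
  split_ifs
  · linarith [escapeProb_mem hx]
  · exact hitProb_le_one hx v

lemma tendsto_returnProb (x : ℤ) :
    Filter.Tendsto (returnProb x) Filter.atTop (nhds 0) := by
  have h1 : Filter.Tendsto (fun v : ℤ => (x : ℝ) / v) Filter.atTop (nhds 0) :=
    tendsto_const_nhds.div_atTop tendsto_intCast_atTop_atTop
  refine h1.congr' ?_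
  filter_upwards [Filter.eventually_gt_atTop x] with v hv
  simp [returnProb, hitProb, hv.ne', not_le.2 hv]

/-- First-step analysis for the hitting probabilities. -/
lemma hitProb_average {u : ℤ} (hx : 1 ≤ x) (hu : 1 ≤ u) :
    hitProb x (u + 1) * (((u : ℝ) + 1) / (2 * u)) + hitProb x (u - 1) * (((u : ℝ) - 1) / (2 * u))
      = returnProb x u := by
  have hx' : (1 : ℝ) ≤ x := by exact_mod_cast hx
  have hu' : (1 : ℝ) ≤ u := by exact_mod_cast hu
  rcases lt_trichotomy u x with h | h | h
  · rw [returnProb, if_neg h.ne, hitProb, hitProb, hitProb, if_pos (by lia), if_pos (by lia),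
      if_pos (by lia)]
    field_simp
    ring
  · subst h
    rw [returnProb, if_pos rfl, hitProb, hitProb, if_neg (by lia), if_pos (by lia)]
    push_cast
    field_simp
    ring
  · have hxu : (x : ℝ) + 1 ≤ u := by exact_mod_cast h
    have hlow : hitProb x (u - 1) = x / ((u : ℝ) - 1) := by
      rcases (show x ≤ u - 1 by lia).eq_or_lt with h2 | h2
      · have : (x : ℝ) = u - 1 := by exact_mod_cast h2
        rw [hitProb, if_pos h2.ge, ← this, div_self (by linarith)]
      · rw [hitProb, if_neg (by lia)]
        push_cast
        rfl
    have hu1 : (u : ℝ) - 1 ≠ 0 := by linarith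
    rw [returnProb, if_neg h.ne', hlow, hitProb, hitProb, if_neg (by lia), if_neg (by lia)]
    push_cast
    field_simp
    ring

lemma visitsProb_nonneg (hx : 1 ≤ x) (j k : ℕ) {r : ℝ} (hr0 : 0 ≤ r) (hr1 : r ≤ 1) :
    0 ≤ visitsProb x j k r := by
  obtain ⟨h0, h1⟩ := escapeProb_mem hx
  unfold visitsProb
  split_ifs
  · linarith
  · exact mul_nonneg hr0 (mul_nonneg h0 (pow_nonneg (by linarith) _))
  · exact le_rfl

lemma visitsProb_le (hx : 1 ≤ x) (j k : ℕ) {r : ℝ} (hr0 : 0 ≤ r) :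
    visitsProb x j k r ≤ (if k = j then 1 else 0) + r := by
  obtain ⟨h0, h1⟩ := escapeProb_mem hx
  unfold visitsProb
  split_ifs
  · linarith
  · rw [zero_add]
    exact mul_le_of_le_one_right hr0
      (mul_le_one₀ h1 (pow_nonneg (by linarith) _) (pow_le_one₀ (by linarith) (by linarith)))
  · linarith

/-- Splitting according to whether the walk currently is at `x`. -/
lemma visitsProb_update (j k : ℕ) (v : ℤ) :
    visitsProb x j (k + if v = x then 1 else 0) (returnProb x v)
      = visitsProb x j k (hitProb x v) := by
  by_cases hv : v = x
  · subst hv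
    simp only [returnProb, hitProb, visitsProb, if_true, le_refl]
    rcases lt_trichotomy (k + 1) j with h | h | h
    · rw [if_neg h.ne, if_pos h, if_neg (by lia), if_pos (by lia),
        show j - k - 1 = (j - (k + 1) - 1) + 1 by lia, pow_succ]
      ring
    · subst h
      simp
    · rw [if_neg h.ne', if_neg (by lia)]
      rcases (show j ≤ k by lia).eq_or_lt with h2 | h2
      · simp [h2]
      · rw [if_neg h2.ne', if_neg (by lia)]
  · simp [returnProb, hv]

lemma visitsProb_average (j k : ℕ) {a b r s : ℝ} (hab : a + b = 1) :
    visitsProb x j k r * a + visitsProb x j k s * b = visitsProb x j k (r * a + s * b) := by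
  unfold visitsProb
  split_ifs
  · linear_combination hab
  · ring
  · ring

end HittingProbabilities

/-- The number of visits of a history to `x`. -/
def visits (x : ℤ) {n : ℕ} (γ : Fin n → ℤ) : ℕ := ∑ i, if γ i = x then 1 else 0

namespace IsCondWalk

variable {Ω : Type*} [MeasurableSpace Ω] {Pr : Measure Ω} {X : ℕ → Ω → ℤ} {x : ℤ}

lemma lintegral_visitsProb_next (h : IsCondWalk Pr X x) (hx : 1 ≤ x) (j t : ℕ) :
    ∫⁻ ω, ENNReal.ofReal (visitsProb x j (visits x fun i : Fin (t + 1 + 1) => X i ω)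
        (returnProb x (X (t + 1) ω))) ∂Pr
      = ∫⁻ ω, ENNReal.ofReal (visitsProb x j (visits x fun i : Fin (t + 1) => X i ω)
        (returnProb x (X t ω))) ∂Pr := by
  have e1 (ω : Ω) : visits x (fun i : Fin (t + 1 + 1) => X i ω)
      = visits x (fun i : Fin (t + 1) => X i ω) + if X (t + 1) ω = x then 1 else 0 := by
    simp only [visits, Fin.sum_univ_castSucc, Fin.val_castSucc, Fin.val_last]
  simp only [e1, visitsProb_update]
  rw [h.lintegral_history_next t fun γ v =>
    ENNReal.ofReal (visitsProb x j (visits x γ) (hitProb x v))]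
  refine lintegral_congr_ae ?_
  filter_upwards [h.ae_pos hx t] with ω hω
  have hω' : (1 : ℝ) ≤ X t ω := by exact_mod_cast hω
  have hnn (k : ℕ) (v : ℤ) : 0 ≤ visitsProb x j k (hitProb x v) :=
    visitsProb_nonneg hx j k (hitProb_nonneg hx v) (hitProb_le_one hx v)
  rw [ofReal_condStep_average hω (hnn _ _) (hnn _ _), visitsProb_average, hitProb_average hx hω]
  field_simp
  ring

lemma lintegral_visitsProb (h : IsCondWalk Pr X x) (hx : 1 ≤ x) {j : ℕ} (hj : 1 ≤ j) (t : ℕ) :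
    ∫⁻ ω, ENNReal.ofReal (visitsProb x j (visits x fun i : Fin (t + 1) => X i ω)
        (returnProb x (X t ω))) ∂Pr
      = ENNReal.ofReal (1 / (2 * (x : ℝ)) * (1 - 1 / (2 * (x : ℝ))) ^ (j - 1)) := by
  have := h.1
  induction t with
  | zero =>
    have e1 : ∀ᵐ ω ∂Pr, ENNReal.ofReal (visitsProb x j (visits x fun i : Fin (0 + 1) => X i ω)
        (returnProb x (X 0 ω)))
        = ENNReal.ofReal (1 / (2 * (x : ℝ)) * (1 - 1 / (2 * (x : ℝ))) ^ (j - 1)) := by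
      filter_upwards [h.ae_start] with ω hω
      have hv : visits x (fun i : Fin (0 + 1) => X i ω) = 0 + if x = x then 1 else 0 := by
        simp [visits, hω]
      rw [hv, hω, visitsProb_update, visitsProb, if_neg (by lia), if_pos (by lia)]
      simp [hitProb]
    rw [lintegral_congr_ae e1]
    simp
  | succ t ih => rw [h.lintegral_visitsProb_next hx, ih]

end IsCondWalk

/-- The number of visits up to time `t` eventually equals `j ≥ 1` exactly when the total number
of visits does. -/
lemma eventually_visits_eq_iff (y : ℕ → ℤ) (x : ℤ) {j : ℕ} (hj : 1 ≤ j) :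
    ∀ᶠ t in Filter.atTop,
      ((visits x fun i : Fin (t + 1) => y i) = j ↔ {t | y t = x}.ncard = j) := by
  have hvis (t : ℕ) : (visits x fun i : Fin (t + 1) => y i)
      = #{s ∈ range (t + 1) | y s = x} := by
    rw [visits, Finset.card_filter, Finset.sum_range]
  simp only [hvis]
  by_cases hfin : {t | y t = x}.Finite
  · obtain ⟨M, hM⟩ := hfin.bddAbove
    filter_upwards [Filter.eventually_ge_atTop M] with t ht
    have : {t | y t = x} = (({s ∈ range (t + 1) | y s = x} : Finset ℕ) : Set ℕ) := by
      ext s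
      simp only [Set.mem_ofPred_eq, coe_filter, Finset.mem_range, iff_and_self]
      intro hs
      have := hM hs
      lia
    rw [this, Set.ncard_coe_finset]
  · have hinf : {t | y t = x}.Infinite := hfin
    obtain ⟨T, hT, hTc⟩ := hinf.exists_subset_card_eq (j + 1)
    filter_upwards [Filter.eventually_ge_atTop (T.sup id)] with t ht
    rw [hinf.ncard]
    have : T ⊆ {s ∈ range (t + 1) | y s = x} := fun s hs => by
      have h1 : s ≤ T.sup id := Finset.le_sup (f := id) hs
      exact Finset.mem_filter.2 ⟨Finset.mem_range.2 (by lia), hT hs⟩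
    have := Finset.card_le_card this
    lia

/-- for the conditioned walk started at `x ≥ 1`, the total number
of visits to `x`, namely `#{t ≥ 0 : X_t = x}`, is geometric with success
probability `1/(2x)`: for every integer `j ≥ 1`,
`P̂_x[#{t : X_t = x} = j] = (1/(2x)) (1 - 1/(2x))^(j-1)`. -/
theorem cond_walk_number_of_visits_geometric
    {Ω : Type*} [MeasurableSpace Ω] (Pr : Measure Ω) (X : ℕ → Ω → ℤ)
    (x : ℤ) (hx : 1 ≤ x) (h : IsCondWalk Pr X x) :
    ∀ j : ℕ, 1 ≤ j →
      Pr {ω | {t : ℕ | X t ω = x}.ncard = j}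
        = ENNReal.ofReal
            ((1 / (2 * (x : ℝ))) * (1 - 1 / (2 * (x : ℝ))) ^ (j - 1)) := by
  intro j hj
  have := h.1
  have hHmeas (t : ℕ) : Measurable fun ω (i : Fin (t + 1)) => X i ω :=
    measurable_pi_lambda _ fun i => h.2.1 i
  set A : ℕ → Set Ω := fun t => {ω | (visits x fun i : Fin (t + 1) => X i ω) = j} with hA
  have hAm (t : ℕ) : MeasurableSet (A t) :=
    (Measurable.of_discrete (f := visits x)).comp (hHmeas t) (measurableSet_singleton j)
  set c := ENNReal.ofReal ((1 / (2 * (x : ℝ))) * (1 - 1 / (2 * (x : ℝ))) ^ (j - 1)) with hc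
  set e : ℕ → ℝ≥0∞ := fun t => ∫⁻ ω, ENNReal.ofReal (returnProb x (X t ω)) ∂Pr with he
  have he0 : Filter.Tendsto e Filter.atTop (nhds 0) := by
    refine h.tendsto_lintegral_zero hx (g := fun v => ENNReal.ofReal (returnProb x v))
      (fun v => ENNReal.ofReal_le_one.2 (returnProb_le_one hx v)) ?_
    simpa using ENNReal.tendsto_ofReal (tendsto_returnProb x)
  have hlim : Filter.Tendsto (fun t => Pr (A t)) Filter.atTop
      (nhds (Pr {ω | {t : ℕ | X t ω = x}.ncard = j})) :=
    tendsto_measure_of_tendsto_indicator_of_isFiniteMeasure Filter.atTop Pr hAm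
      fun ω => eventually_visits_eq_iff (fun t => X t ω) x hj
  have hr (t : ℕ) : Measurable fun ω => ENNReal.ofReal (returnProb x (X t ω)) :=
    (Measurable.of_discrete (f := fun v => ENNReal.ofReal (returnProb x v))).comp (h.2.1 t)
  have hind (t : ℕ) (ω : Ω) : (A t).indicator 1 ω
      = ENNReal.ofReal (if (visits x fun i : Fin (t + 1) => X i ω) = j then 1 else 0) := by
    by_cases hω : (visits x fun i : Fin (t + 1) => X i ω) = j <;> simp [hA, hω]
  have hnn (k : ℕ) : (0 : ℝ) ≤ if k = j then 1 else 0 := by split_ifs <;> norm_num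
  have hup (t : ℕ) : c ≤ Pr (A t) + e t := by
    rw [hc, ← h.lintegral_visitsProb hx hj t, ← lintegral_indicator_one (hAm t), he,
      ← lintegral_add_right _ (hr t)]
    refine lintegral_mono fun ω => ?_
    rw [hind, ← ENNReal.ofReal_add (hnn _) (returnProb_nonneg hx _)]
    exact ENNReal.ofReal_le_ofReal (visitsProb_le hx _ _ (returnProb_nonneg hx _))
  have hlow (t : ℕ) : Pr (A t) ≤ c + e t := by
    rw [hc, ← h.lintegral_visitsProb hx hj t, ← lintegral_indicator_one (hAm t), he,
      ← lintegral_add_right _ (hr t)]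
    refine lintegral_mono fun ω => ?_
    have hv := visitsProb_nonneg hx j (visits x fun i : Fin (t + 1) => X i ω)
      (returnProb_nonneg hx (X t ω)) (returnProb_le_one hx (X t ω))
    rw [hind, ← ENNReal.ofReal_add hv (returnProb_nonneg hx _)]
    refine ENNReal.ofReal_le_ofReal ?_
    split_ifs with hk
    · simp [visitsProb, hk]
    · exact add_nonneg hv (returnProb_nonneg hx _)
  refine le_antisymm ?_ ?_
  · exact le_of_tendsto_of_tendsto' hlim (by simpa using tendsto_const_nhds.add he0) hlow
  · exact ge_of_tendsto' (by simpa using hlim.add he0) hup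
end

section
/- Fix α > 0 and positive integers a, b. For each n set t_n = ⌊ α n³ / (2π²) ⌋ and x_n = ⌊n/2⌋. Then lim_{n→∞} P_{x_n}[ τ_{{b, n−a}} > t_n | τ_{{0,n}} > t_n ] = exp( −α(a+b)/2 ). Equivalently, for the random walk on the ring graph with n sites started at ⌊n/2⌋ and conditioned not to hit the origin up to time t_n, the probability that the whole interval [−a, b] (around the origin of the ring) remains unvisited up to time t_n converges to exp(−α(a+b)/2), which is the law of the vacant set of one-dimensional random interlacements at level α. -/
open MeasureTheory ProbabilityTheory Finset Filter
open scoped ENNReal Topology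

/-- One step transition probability of the simple random walk on `ℤ`. -/
noncomputable def srwStep (u v : ℤ) : ℝ≥0∞ :=
  if v = u + 1 ∨ v = u - 1 then (1 : ℝ≥0∞) / 2 else 0

/-- `P x` is the law of the simple random walk `S` on `ℤ` started at `x`:
for every finite path `γ` with `γ 0 = x`, the probability of following `γ`
during the first `t` steps is the product of the one-step transition
probabilities. -/
def IsSRW {Ω : Type*} [MeasurableSpace Ω] (P : ℤ → Measure Ω) (S : ℕ → Ω → ℤ) : Prop :=
  (∀ x, IsProbabilityMeasure (P x)) ∧ (∀ t, Measurable (S t)) ∧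
    ∀ (x : ℤ) (t : ℕ) (γ : ℕ → ℤ), γ 0 = x →
      P x {ω | ∀ s ≤ t, S s ω = γ s} = ∏ s ∈ Finset.range t, srwStep (γ s) (γ (s + 1))

/-- The probability that the simple random walk started at `x` stays in `D` up to time `t`,
computed by conditioning on the first step. -/
noncomputable def stayProb (D : Set ℤ) : ℕ → ℤ → ℝ≥0∞
  | 0, x => D.indicator 1 x
  | t + 1, x => D.indicator (fun x => ∑' v, srwStep x v * stayProb D t v) x

lemma tsum_srwStep_mul (x : ℤ) (g : ℤ → ℝ≥0∞) :
    ∑' v, srwStep x v * g v = 1 / 2 * g (x + 1) + 1 / 2 * g (x - 1) := by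
  rw [tsum_eq_sum (s := {x + 1, x - 1}), Finset.sum_pair (by omega)]
  · simp [srwStep]
  · intro v hv
    have : ¬ (v = x + 1 ∨ v = x - 1) := by simpa using hv
    simp [srwStep, this]

section PathLaw

variable {Ω : Type*} [MeasurableSpace Ω] {P : ℤ → Measure Ω} {S : ℕ → Ω → ℤ}

lemma IsSRW.measure_path_inter_stay (hS : IsSRW P S) (D : Set ℤ) (x : ℤ) (j : ℕ) :
    ∀ (T : ℕ) (γ : ℕ → ℤ), γ 0 = x →
      P x ({ω | ∀ s ≤ T, S s ω = γ s} ∩ {ω | ∀ s ≤ j, S (T + s) ω ∈ D}) =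
        P x {ω | ∀ s ≤ T, S s ω = γ s} * stayProb D j (γ T) := by
  induction j with
  | zero =>
    intro T γ hγ
    by_cases h : γ T ∈ D
    · have : {ω | ∀ s ≤ T, S s ω = γ s} ∩ {ω | ∀ s ≤ 0, S (T + s) ω ∈ D} =
          {ω | ∀ s ≤ T, S s ω = γ s} := by
        ext ω
        simp only [Set.mem_inter_iff, Set.mem_ofPred_eq, and_iff_left_iff_imp]
        intro h' s hs
        obtain rfl : s = 0 := by omega
        rw [add_zero, h' T le_rfl]
        exact h
      rw [this]
      simp [stayProb, h]
    · have : {ω | ∀ s ≤ T, S s ω = γ s} ∩ {ω | ∀ s ≤ 0, S (T + s) ω ∈ D} = ∅ := by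
        ext ω
        simp only [Set.mem_inter_iff, Set.mem_ofPred_eq, Set.mem_empty_iff_false, iff_false]
        rintro ⟨h1, h2⟩
        have := h2 0 le_rfl
        rw [add_zero, h1 T le_rfl] at this
        exact h this
      rw [this]
      simp [stayProb, h]
  | succ j ih =>
    intro T γ hγ
    by_cases h : γ T ∈ D
    · have hsplit : ∀ v : ℤ,
          ({ω | ∀ s ≤ T, S s ω = γ s} ∩ {ω | ∀ s ≤ j + 1, S (T + s) ω ∈ D}) ∩
            (S (T + 1) ⁻¹' {v}) =
          {ω | ∀ s ≤ T + 1, S s ω = Function.update γ (T + 1) v s} ∩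
            {ω | ∀ s ≤ j, S (T + 1 + s) ω ∈ D} := by
        intro v
        ext ω
        simp only [Set.mem_inter_iff, Set.mem_ofPred_eq, Set.mem_preimage, Set.mem_singleton_iff]
        constructor
        · rintro ⟨⟨h1, h2⟩, h3⟩
          refine ⟨fun s hs => ?_, fun s hs => ?_⟩
          · rcases Nat.lt_or_ge s (T + 1) with hs' | hs'
            · rw [Function.update_of_ne (by omega)]
              exact h1 s (by omega)
            · obtain rfl : s = T + 1 := by omega
              simpa using h3
          · have := h2 (s + 1) (by omega)
            rwa [show T + (s + 1) = T + 1 + s by ring] at this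
        · rintro ⟨h1, h2⟩
          have h1' : ∀ s ≤ T, S s ω = γ s := fun s hs => by
            have := h1 s (by omega)
            rwa [Function.update_of_ne (by omega)] at this
          refine ⟨⟨h1', fun s hs => ?_⟩, by simpa using h1 (T + 1) le_rfl⟩
          rcases s with _ | s
          · rw [add_zero, h1' T le_rfl]
            exact h
          · have := h2 s (by omega)
            rwa [show T + 1 + s = T + (s + 1) by ring] at this
      have hstep : ∀ v : ℤ, P x {ω | ∀ s ≤ T + 1, S s ω = Function.update γ (T + 1) v s} =
          P x {ω | ∀ s ≤ T, S s ω = γ s} * srwStep (γ T) v := by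
        intro v
        rw [hS.2.2 x (T + 1) _ (by simpa using hγ), hS.2.2 x T γ hγ, Finset.prod_range_succ]
        congr 1
        · refine Finset.prod_congr rfl fun s hs => ?_
          have := Finset.mem_range.1 hs
          rw [Function.update_of_ne (by omega), Function.update_of_ne (by omega)]
        · simp
      have hsum : ∀ A : Set Ω, P x A = ∑' v : ℤ, P x (A ∩ (S (T + 1) ⁻¹' {v})) := by
        intro A
        have hm : ∀ v : ℤ, MeasurableSet (S (T + 1) ⁻¹' {v}) := fun v =>
          hS.2.1 (T + 1) (measurableSet_singleton v)
        have := tsum_measure_preimage_singleton (μ := (P x).restrict A)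
          (Set.countable_univ (α := ℤ)) (f := S (T + 1)) fun v _ => hm v
        rw [Set.preimage_univ, Measure.restrict_apply_univ, tsum_univ
          (f := fun v => (P x).restrict A (S (T + 1) ⁻¹' {v}))] at this
        rw [← this]
        exact tsum_congr fun v => by rw [Measure.restrict_apply (hm v), Set.inter_comm]
      rw [hsum]
      simp_rw [hsplit]
      have : ∀ v : ℤ, P x ({ω | ∀ s ≤ T + 1, S s ω = Function.update γ (T + 1) v s} ∩
            {ω | ∀ s ≤ j, S (T + 1 + s) ω ∈ D}) =
          P x {ω | ∀ s ≤ T, S s ω = γ s} * (srwStep (γ T) v * stayProb D j v) := by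
        intro v
        rw [ih (T + 1) _ (by simpa using hγ), hstep, mul_assoc]
        simp
      simp_rw [this, ENNReal.tsum_mul_left]
      simp [stayProb, h]
    · have : {ω | ∀ s ≤ T, S s ω = γ s} ∩ {ω | ∀ s ≤ j + 1, S (T + s) ω ∈ D} = ∅ := by
        ext ω
        simp only [Set.mem_inter_iff, Set.mem_ofPred_eq, Set.mem_empty_iff_false, iff_false]
        rintro ⟨h1, h2⟩
        have := h2 0 (by omega)
        rw [add_zero, h1 T le_rfl] at this
        exact h this
      rw [this]
      simp [stayProb, h]

lemma IsSRW.measure_stay (hS : IsSRW P S) (D : Set ℤ) (x : ℤ) (t : ℕ) :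
    P x {ω | ∀ s ≤ t, S s ω ∈ D} = stayProb D t x := by
  have := hS.1 x
  have h0 : P x {ω | ∀ s ≤ 0, S s ω = x} = 1 := by
    simpa using hS.2.2 x 0 (fun _ => x) rfl
  have h0' : ∀ᵐ ω ∂P x, ω ∈ {ω | ∀ s ≤ 0, S s ω = x} := by
    rw [← prob_compl_eq_zero_iff₀] at h0
    · exact h0
    · have : {ω | ∀ s ≤ 0, S s ω = x} = S 0 ⁻¹' {x} := by ext; simp
      rw [this]
      exact (hS.2.1 0 (measurableSet_singleton x)).nullMeasurableSet
  have h := hS.measure_path_inter_stay D x t 0 (fun _ => x) rfl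
  rw [h0, one_mul] at h
  rw [← h]
  refine measure_congr ?_
  filter_upwards [h0'] with ω hω
  apply propext
  simp only [zero_add]
  exact ⟨fun h => ⟨hω, h⟩, fun h => h.2⟩

end PathLaw

/-- The `k`-th odd multiple of `π / (2N)`. -/
noncomputable def oddAngle (N k : ℕ) : ℝ := (2 * k + 1) * Real.pi / (2 * N)

/-- The spectral expansion of the probability that the simple random walk started at `y`
stays in `(0, N)` up to time `t`. -/
noncomputable def spectralSurvival (N t : ℕ) (y : ℤ) : ℝ :=
  (1 / N) * ∑ k ∈ range N, Real.cos (oddAngle N k) / Real.sin (oddAngle N k) *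
    Real.sin (2 * y * oddAngle N k) * Real.cos (2 * oddAngle N k) ^ t

lemma oddAngle_pos {N : ℕ} (hN : 0 < N) (k : ℕ) : 0 < oddAngle N k := by
  have := Real.pi_pos
  unfold oddAngle
  positivity

lemma oddAngle_add_reflect {N k : ℕ} (hk : k < N) :
    oddAngle N k + oddAngle N (N - 1 - k) = Real.pi := by
  have hN : (N : ℝ) ≠ 0 := by
    have : 0 < N := by omega
    positivity
  have h : ((N - 1 - k : ℕ) : ℝ) = N - 1 - k := by
    rw [Nat.cast_sub (by omega), Nat.cast_sub (by omega)]
    simp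
  unfold oddAngle
  rw [h]
  field_simp
  ring

lemma oddAngle_lt_pi {N k : ℕ} (hk : k < N) : oddAngle N k < Real.pi := by
  have := oddAngle_add_reflect hk
  have := oddAngle_pos (by omega : 0 < N) (N - 1 - k)
  linarith

lemma sin_oddAngle_pos {N k : ℕ} (hk : k < N) : 0 < Real.sin (oddAngle N k) :=
  Real.sin_pos_of_pos_of_lt_pi (oddAngle_pos (by omega) k) (oddAngle_lt_pi hk)

lemma mul_oddAngle {N : ℕ} (hN : 0 < N) (k : ℕ) : 2 * N * oddAngle N k = (2 * k + 1) * Real.pi := by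
  have : (N : ℝ) ≠ 0 := by positivity
  unfold oddAngle
  field_simp

lemma spectralSurvival_zero_right (N t : ℕ) : spectralSurvival N t 0 = 0 := by
  simp [spectralSurvival]

lemma spectralSurvival_self {N : ℕ} (hN : 0 < N) (t : ℕ) : spectralSurvival N t N = 0 := by
  unfold spectralSurvival
  rw [Finset.sum_eq_zero, mul_zero]
  intro k _
  have : Real.sin (2 * ((N : ℤ) : ℝ) * oddAngle N k) = 0 := by
    rw [Int.cast_natCast, mul_oddAngle hN]
    have := Real.sin_nat_mul_pi (2 * k + 1)
    push_cast at this
    exact this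
  rw [this, mul_zero, zero_mul]

lemma spectralSurvival_succ (N t : ℕ) (y : ℤ) : spectralSurvival N (t + 1) y =
    1 / 2 * spectralSurvival N t (y + 1) + 1 / 2 * spectralSurvival N t (y - 1) := by
  unfold spectralSurvival
  simp only [Finset.mul_sum]
  rw [← Finset.sum_add_distrib]
  refine Finset.sum_congr rfl fun k _ => ?_
  push_cast
  rw [show 2 * ((y : ℝ) + 1) * oddAngle N k = 2 * y * oddAngle N k + 2 * oddAngle N k by ring,
    show 2 * ((y : ℝ) - 1) * oddAngle N k = 2 * y * oddAngle N k - 2 * oddAngle N k by ring,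
    Real.sin_add, Real.sin_sub, pow_succ]
  ring

lemma sum_cos_oddAngle {N j : ℕ} (hj : 0 < j) (hjN : j < N) :
    ∑ k ∈ range N, Real.cos (2 * j * oddAngle N k) = 0 := by
  have hN : (0 : ℝ) < N := by
    have : 0 < N := by omega
    positivity
  have hj' : (0 : ℝ) < j := by positivity
  have hjN' : (j : ℝ) < N := by exact_mod_cast hjN
  have hpi := Real.pi_pos
  have hs : 0 < Real.sin (Real.pi * j / N) := by
    apply Real.sin_pos_of_pos_of_lt_pi
    · positivity
    · rw [div_lt_iff₀ hN]
      exact mul_lt_mul_of_pos_left hjN' hpi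
  have htel : ∑ k ∈ range N, Real.cos (2 * j * oddAngle N k) * (2 * Real.sin (Real.pi * j / N)) =
      ∑ k ∈ range N, (Real.sin (2 * ((k + 1 : ℕ) : ℝ) * (Real.pi * j / N)) -
        Real.sin (2 * (k : ℝ) * (Real.pi * j / N))) := by
    refine Finset.sum_congr rfl fun k _ => ?_
    have h1 : 2 * ((k + 1 : ℕ) : ℝ) * (Real.pi * j / N) =
        2 * j * oddAngle N k + Real.pi * j / N := by
      unfold oddAngle
      push_cast
      field_simp
      ring
    have h2 : 2 * (k : ℝ) * (Real.pi * j / N) = 2 * j * oddAngle N k - Real.pi * j / N := by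
      unfold oddAngle
      field_simp
      ring
    rw [h1, h2, Real.sin_add, Real.sin_sub]
    ring
  rw [Finset.sum_range_sub (fun k : ℕ => Real.sin (2 * (k : ℝ) * (Real.pi * j / N))),
    ← Finset.sum_mul] at htel
  have h3 : Real.sin (2 * (N : ℝ) * (Real.pi * j / N)) = 0 := by
    rw [show 2 * (N : ℝ) * (Real.pi * j / N) = ((2 * j : ℕ) : ℝ) * Real.pi by
      push_cast; field_simp]
    exact Real.sin_nat_mul_pi _
  rw [h3] at htel
  simp only [CharP.cast_eq_zero, mul_zero, zero_mul, Real.sin_zero, sub_zero] at htel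
  rcases mul_eq_zero.1 htel with h | h
  · exact h
  · linarith

lemma sum_cot_mul_sin_oddAngle {N y : ℕ} (hyN : y + 1 < N) :
    ∑ k ∈ range N, Real.cos (oddAngle N k) / Real.sin (oddAngle N k) *
      Real.sin (2 * (y + 1 : ℕ) * oddAngle N k) = N := by
  induction y with
  | zero =>
    have h : ∀ k ∈ range N, Real.cos (oddAngle N k) / Real.sin (oddAngle N k) *
        Real.sin (2 * (0 + 1 : ℕ) * oddAngle N k) =
        1 + Real.cos (2 * (1 : ℕ) * oddAngle N k) := by
      intro k hk
      have := (sin_oddAngle_pos (Finset.mem_range.1 hk)).ne'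
      simp only [zero_add, Nat.cast_one, mul_one]
      rw [Real.sin_two_mul, Real.cos_two_mul]
      field_simp
      ring
    rw [Finset.sum_congr rfl h, Finset.sum_add_distrib, sum_cos_oddAngle one_pos (by omega)]
    simp
  | succ y ih =>
    rw [← ih (by omega), ← sub_eq_zero, ← Finset.sum_sub_distrib]
    have h : ∀ k ∈ range N, Real.cos (oddAngle N k) / Real.sin (oddAngle N k) *
        Real.sin (2 * (y + 1 + 1 : ℕ) * oddAngle N k) -
        Real.cos (oddAngle N k) / Real.sin (oddAngle N k) *
        Real.sin (2 * (y + 1 : ℕ) * oddAngle N k) =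
        Real.cos (2 * (y + 1 + 1 : ℕ) * oddAngle N k) +
          Real.cos (2 * (y + 1 : ℕ) * oddAngle N k) := by
      intro k hk
      have := (sin_oddAngle_pos (Finset.mem_range.1 hk)).ne'
      have e1 : 2 * ((y + 1 + 1 : ℕ) : ℝ) * oddAngle N k =
          (2 * y + 3) * oddAngle N k + oddAngle N k := by push_cast; ring
      have e2 : 2 * ((y + 1 : ℕ) : ℝ) * oddAngle N k =
          (2 * y + 3) * oddAngle N k - oddAngle N k := by push_cast; ring
      rw [e1, e2, Real.sin_add, Real.sin_sub, Real.cos_add, Real.cos_sub]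
      field_simp
      ring
    rw [Finset.sum_congr rfl h, Finset.sum_add_distrib, sum_cos_oddAngle (by omega) hyN,
      sum_cos_oddAngle (by omega) (by omega), add_zero]

lemma spectralSurvival_zero_left {N : ℕ} {y : ℤ} (hy : 0 < y) (hyN : y < N) :
    spectralSurvival N 0 y = 1 := by
  obtain ⟨m, rfl⟩ : ∃ m : ℕ, y = ((m + 1 : ℕ) : ℤ) := ⟨(y - 1).toNat, by omega⟩
  have hN : (N : ℝ) ≠ 0 := by
    have : 0 < N := by omega
    positivity
  simp only [spectralSurvival, pow_zero, mul_one, Int.cast_natCast]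
  rw [sum_cot_mul_sin_oddAngle (by omega)]
  field_simp

lemma stayProb_eq_spectralSurvival {D : Set ℤ} {c : ℤ} {N : ℕ} (hN : 0 < N) (hc : c ∉ D)
    (hcN : c + N ∉ D) (hD : ∀ y, c < y → y < c + N → y ∈ D) (t : ℕ) :
    ∀ x, c ≤ x → x ≤ c + N → stayProb D t x = ENNReal.ofReal (spectralSurvival N t (x - c)) ∧
      0 ≤ spectralSurvival N t (x - c) := by
  have hbdry : ∀ t x, x = c ∨ x = c + N →
      stayProb D t x = ENNReal.ofReal (spectralSurvival N t (x - c)) ∧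
      0 ≤ spectralSurvival N t (x - c) := by
    rintro t x (rfl | rfl)
    · cases t <;> simp [stayProb, hc, spectralSurvival_zero_right]
    · rw [add_sub_cancel_left, spectralSurvival_self hN]
      cases t <;> simp [stayProb, hcN]
  induction t with
  | zero =>
    intro x h1 h2
    by_cases hx : x = c ∨ x = c + N
    · exact hbdry 0 x hx
    · have hxD := hD x (by omega) (by omega)
      rw [spectralSurvival_zero_left (by omega) (by omega)]
      simp [stayProb, hxD]
  | succ t ih =>
    intro x h1 h2
    by_cases hx : x = c ∨ x = c + N
    · exact hbdry _ x hx
    · have hxD := hD x (by omega) (by omega)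
      obtain ⟨hp, hp0⟩ := ih (x + 1) (by omega) (by omega)
      obtain ⟨hm, hm0⟩ := ih (x - 1) (by omega) (by omega)
      rw [show x + 1 - c = x - c + 1 by ring] at hp hp0
      rw [show x - 1 - c = x - c - 1 by ring] at hm hm0
      rw [spectralSurvival_succ]
      refine ⟨?_, by positivity⟩
      simp only [stayProb, Set.indicator_of_mem hxD, tsum_srwStep_mul]
      rw [hp, hm, ENNReal.ofReal_add (by positivity) (by positivity),
        ENNReal.ofReal_mul (by positivity), ENNReal.ofReal_mul (by positivity)]
      simp

lemma cos_pi_div_nonneg {N : ℕ} (hN : 2 ≤ N) : 0 ≤ Real.cos (Real.pi / N) := by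
  have hpi := Real.pi_pos
  have : 0 ≤ Real.pi / N := by positivity
  exact Real.cos_nonneg_of_mem_Icc ⟨by linarith,
    div_le_div_of_nonneg_left hpi.le (by norm_num) (by exact_mod_cast hN)⟩

lemma cos_pi_div_pos {N : ℕ} (hN : 3 ≤ N) : 0 < Real.cos (Real.pi / N) := by
  have hpi := Real.pi_pos
  have : 0 ≤ Real.pi / N := by positivity
  exact Real.cos_pos_of_mem_Ioo ⟨by linarith,
    div_lt_div_of_pos_left hpi (by norm_num) (by exact_mod_cast hN)⟩

lemma one_div_le_sin_oddAngle {N k : ℕ} (hk : k < N) : 1 / (N : ℝ) ≤ Real.sin (oddAngle N k) := by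
  have hN : (0 : ℝ) < N := by
    have : 0 < N := by omega
    positivity
  have hpi := Real.pi_pos
  have key : ∀ j : ℕ, oddAngle N j ≤ Real.pi / 2 → 1 / (N : ℝ) ≤ Real.sin (oddAngle N j) := by
    intro j hj
    refine le_trans ?_ (Real.mul_le_sin (oddAngle_pos (by omega) j).le hj)
    have : 2 / Real.pi * oddAngle N j = (2 * j + 1) / N := by
      unfold oddAngle
      field_simp
    rw [this]
    gcongr
    linarith [(Nat.cast_nonneg j : (0 : ℝ) ≤ j)]
  have hr := oddAngle_add_reflect hk
  rcases le_total (oddAngle N k) (Real.pi / 2) with h | h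
  · exact key k h
  · rw [← Real.sin_pi_sub, ← hr, add_sub_cancel_left]
    exact key _ (by linarith)

lemma abs_cos_le_cos {v w : ℝ} (hw : 0 ≤ w) (h1 : w ≤ v) (h2 : v ≤ Real.pi - w) :
    |Real.cos v| ≤ Real.cos w := by
  rw [abs_le]
  constructor
  · have := Real.cos_le_cos_of_nonneg_of_le_pi hw (by linarith) (by linarith : w ≤ Real.pi - v)
    rw [Real.cos_pi_sub] at this
    linarith
  · exact Real.cos_le_cos_of_nonneg_of_le_pi hw (by linarith) h1

lemma abs_cot_mul_abs_cos_pow_le {N k : ℕ} (hk : 0 < k) (hkN : k + 1 < N) (t : ℕ) :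
    |Real.cos (oddAngle N k) / Real.sin (oddAngle N k)| * |Real.cos (2 * oddAngle N k)| ^ t ≤
      (N * Real.cos (Real.pi / N) ^ t + Real.pi / N) * Real.cos (Real.pi / N) ^ t := by
  have hN3 : 3 ≤ N := by omega
  have hNr : (3 : ℝ) ≤ N := by exact_mod_cast hN3
  have hN : (0 : ℝ) < N := by linarith
  have hpi := Real.pi_pos
  have hC : 0 < Real.cos (Real.pi / N) := cos_pi_div_pos hN3
  have hCt : 0 < Real.cos (Real.pi / N) ^ t := pow_pos hC t
  obtain ⟨e, he⟩ : ∃ e : ℤ, e = 2 * k + 1 - N := ⟨_, rfl⟩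
  have hθ : oddAngle N k = Real.pi / 2 + e * Real.pi / (2 * N) := by
    rw [he]
    unfold oddAngle
    push_cast
    field_simp
    ring
  have hcos2 : |Real.cos (2 * oddAngle N k)| = |Real.cos (e.natAbs * Real.pi / N)| := by
    rw [hθ, show 2 * (Real.pi / 2 + e * Real.pi / (2 * N)) = e * Real.pi / N + Real.pi by
      field_simp
      ring, Real.cos_add_pi, abs_neg, ← Real.cos_abs, Nat.cast_natAbs, Int.cast_abs, abs_div,
      abs_mul, abs_of_pos hpi, abs_of_pos hN]
  have hsin := sin_oddAngle_pos (N := N) (k := k) (by omega)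
  rcases Nat.lt_or_ge e.natAbs 2 with h | h
  · have hcos : |Real.cos (oddAngle N k)| ≤ e.natAbs * (Real.pi / (2 * N)) := by
      rw [hθ, add_comm, Real.cos_add_pi_div_two, abs_neg]
      refine Real.abs_sin_le_abs.trans_eq ?_
      rw [Nat.cast_natAbs, Int.cast_abs, abs_div, abs_mul, abs_of_pos hpi,
        abs_of_pos (by positivity : (0 : ℝ) < 2 * N)]
      ring
    have hsin2 : 1 / 2 ≤ Real.sin (oddAngle N k) := by
      have h1 : Real.sin (oddAngle N k) ^ 2 + Real.cos (oddAngle N k) ^ 2 = 1 :=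
        Real.sin_sq_add_cos_sq _
      have h2 : |Real.cos (oddAngle N k)| ≤ 3 / 4 := by
        refine hcos.trans ?_
        have h3 : (e.natAbs : ℝ) ≤ 1 := by exact_mod_cast (by omega : e.natAbs ≤ 1)
        have h4 : Real.pi / (2 * N) ≤ 3 / 4 := by
          rw [div_le_iff₀ (by positivity)]
          linarith [Real.pi_lt_four]
        have h5 : 0 ≤ Real.pi / (2 * N) := by positivity
        nlinarith
      have h3 : Real.cos (oddAngle N k) ^ 2 ≤ (3 / 4) ^ 2 := sq_le_sq' (by
        linarith [neg_abs_le (Real.cos (oddAngle N k))]) ((le_abs_self _).trans h2)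
      nlinarith
    have hcot : |Real.cos (oddAngle N k) / Real.sin (oddAngle N k)| ≤
        e.natAbs * (Real.pi / N) := by
      rw [abs_div, abs_of_pos hsin, div_le_iff₀ hsin]
      refine hcos.trans ?_
      calc (e.natAbs : ℝ) * (Real.pi / (2 * N)) = e.natAbs * (Real.pi / N) * (1 / 2) := by
            field_simp
        _ ≤ _ := by gcongr
    have hfin : |Real.cos (oddAngle N k) / Real.sin (oddAngle N k)| *
        |Real.cos (2 * oddAngle N k)| ^ t ≤ Real.pi / N * Real.cos (Real.pi / N) ^ t := by
      rcases Nat.lt_or_ge e.natAbs 1 with h' | h'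
      · have h0 : e.natAbs = 0 := by omega
        have : |Real.cos (oddAngle N k) / Real.sin (oddAngle N k)| = 0 :=
          le_antisymm (by simpa [h0] using hcot) (abs_nonneg _)
        rw [this, zero_mul]
        positivity
      · have h1 : e.natAbs = 1 := by omega
        rw [hcos2, h1]
        rw [h1] at hcot
        simp only [Nat.cast_one, one_mul] at hcot ⊢
        rw [abs_of_pos hC]
        gcongr
    refine hfin.trans ?_
    gcongr
    have : 0 ≤ N * Real.cos (Real.pi / N) ^ t := by positivity
    linarith
  · have hcot : |Real.cos (oddAngle N k) / Real.sin (oddAngle N k)| ≤ N := by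
      rw [abs_div, abs_of_pos hsin, div_le_iff₀ hsin]
      refine (Real.abs_cos_le_one _).trans ?_
      have := one_div_le_sin_oddAngle (N := N) (k := k) (by omega)
      rwa [div_le_iff₀' hN] at this
    have hle : |Real.cos (2 * oddAngle N k)| ≤ Real.cos (Real.pi / N) * Real.cos (Real.pi / N) := by
      have hu : (e.natAbs : ℝ) + 2 ≤ N := by exact_mod_cast (by omega : e.natAbs + 2 ≤ N)
      have hl : (2 : ℝ) ≤ e.natAbs := by exact_mod_cast h
      rw [hcos2]
      refine (abs_cos_le_cos (w := 2 * (Real.pi / N)) (by positivity) ?_ ?_).trans ?_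
      · rw [← mul_div_assoc]
        gcongr
      · rw [le_sub_iff_add_le, ← mul_div_assoc, ← add_div, div_le_iff₀ hN, ← add_mul, mul_comm]
        gcongr
      · rw [Real.cos_two_mul]
        nlinarith [Real.cos_le_one (Real.pi / N)]
    calc _ ≤ N * (Real.cos (Real.pi / N) * Real.cos (Real.pi / N)) ^ t := by gcongr
      _ = N * Real.cos (Real.pi / N) ^ t * Real.cos (Real.pi / N) ^ t := by rw [mul_pow]; ring
      _ ≤ _ := by
        gcongr
        have : 0 ≤ Real.pi / N := by positivity
        linarith

lemma abs_spectralSurvival_sub_le {N : ℕ} (hN2 : 2 ≤ N) (t : ℕ) (y : ℤ) :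
    |spectralSurvival N t y -
      2 / N * (Real.cos (Real.pi / (2 * N)) / Real.sin (Real.pi / (2 * N))) *
        Real.sin (Real.pi * (y / N)) * Real.cos (Real.pi / N) ^ t| ≤
      (N * Real.cos (Real.pi / N) ^ t + Real.pi / N) * Real.cos (Real.pi / N) ^ t := by
  obtain ⟨M, rfl⟩ : ∃ M, N = M + 2 := ⟨N - 2, by omega⟩
  obtain ⟨N, hNM⟩ : ∃ N, N = M + 2 := ⟨_, rfl⟩
  have hN : (0 : ℝ) < N := by
    have : 0 < N := by omega
    positivity
  have hpi := Real.pi_pos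
  have hC : 0 ≤ Real.cos (Real.pi / N) := cos_pi_div_nonneg (by omega)
  have h0 : oddAngle N 0 = Real.pi / (2 * N) := by simp [oddAngle]
  have hlast : oddAngle N (M + 1) = Real.pi - Real.pi / (2 * N) := by
    have := oddAngle_add_reflect (N := N) (k := M + 1) (by omega)
    rw [show N - 1 - (M + 1) = 0 by omega, h0] at this
    linarith
  have hsinlast : Real.sin (2 * y * (Real.pi - Real.pi / (2 * N))) =
      -Real.sin (Real.pi * (y / N)) := by
    rw [show 2 * (y : ℝ) * (Real.pi - Real.pi / (2 * N)) =
      -(Real.pi * (y / N)) + y * (2 * Real.pi) by field_simp; ring,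
      Real.sin_add_int_mul_two_pi, Real.sin_neg]
  rw [← hNM]
  have hdecomp : spectralSurvival N t y -
      2 / N * (Real.cos (Real.pi / (2 * N)) / Real.sin (Real.pi / (2 * N))) *
        Real.sin (Real.pi * (y / N)) * Real.cos (Real.pi / N) ^ t =
      1 / N * ∑ k ∈ range M, Real.cos (oddAngle N (k + 1)) / Real.sin (oddAngle N (k + 1)) *
        Real.sin (2 * y * oddAngle N (k + 1)) * Real.cos (2 * oddAngle N (k + 1)) ^ t := by
    unfold spectralSurvival
    rw [show range N = range (M + 1 + 1) by rw [hNM], Finset.sum_range_succ,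
      Finset.sum_range_succ', h0, hlast, hsinlast, Real.cos_pi_sub, Real.sin_pi_sub,
      show 2 * (Real.pi - Real.pi / (2 * N)) = 2 * Real.pi - Real.pi / N by field_simp,
      Real.cos_two_pi_sub, show 2 * (y : ℝ) * (Real.pi / (2 * N)) = Real.pi * (y / N) by field_simp,
      show 2 * (Real.pi / (2 * N)) = Real.pi / N by field_simp]
    ring
  rw [hdecomp, abs_mul, abs_of_pos (by positivity : 0 < 1 / (N : ℝ)), one_div,
    inv_mul_le_iff₀ hN]
  set B := (N * Real.cos (Real.pi / N) ^ t + Real.pi / N) * Real.cos (Real.pi / N) ^ t with hB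
  have hB0 : 0 ≤ B := by positivity
  calc _ ≤ ∑ k ∈ range M, |Real.cos (oddAngle N (k + 1)) / Real.sin (oddAngle N (k + 1)) *
        Real.sin (2 * y * oddAngle N (k + 1)) * Real.cos (2 * oddAngle N (k + 1)) ^ t| :=
        Finset.abs_sum_le_sum_abs _ _
    _ ≤ ∑ k ∈ range M, B := by
        refine Finset.sum_le_sum fun k hk => ?_
        have hkM := Finset.mem_range.1 hk
        refine le_trans ?_ (abs_cot_mul_abs_cos_pow_le (N := N) (k := k + 1) (by omega)
          (by omega) t)
        rw [abs_mul, abs_mul, abs_pow]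
        gcongr
        exact mul_le_of_le_one_right (abs_nonneg _) (Real.abs_sin_le_one _)
    _ = M * B := by simp
    _ ≤ N * B := by
        gcongr
        omega

lemma sin_eq_mul_sinc (x : ℝ) : Real.sin x = x * Real.sinc x := by
  rcases eq_or_ne x 0 with rfl | hx
  · simp
  · rw [Real.sinc_of_ne_zero hx]
    field_simp

lemma tendsto_spectralSurvival_div {N t : ℕ → ℕ} {y : ℕ → ℤ} (hN : Tendsto N atTop atTop)
    (hNt : Tendsto (fun n => (N n : ℝ) * Real.cos (Real.pi / N n) ^ t n) atTop (𝓝 0))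
    (hy : Tendsto (fun n => (y n : ℝ) / N n) atTop (𝓝 (1 / 2))) :
    Tendsto (fun n => spectralSurvival (N n) (t n) (y n) / Real.cos (Real.pi / N n) ^ t n)
      atTop (𝓝 (4 / Real.pi)) := by
  have hpi := Real.pi_pos
  have hNr : Tendsto (fun n => (N n : ℝ)) atTop atTop := tendsto_natCast_atTop_atTop.comp hN
  have hpiN : Tendsto (fun n => Real.pi / (N n : ℝ)) atTop (𝓝 0) := hNr.const_div_atTop _
  have hu : Tendsto (fun n => Real.pi / (2 * N n : ℝ)) atTop (𝓝 0) :=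
    (hNr.const_mul_atTop two_pos).const_div_atTop _
  have hmain : Tendsto (fun n => 4 / Real.pi * (Real.cos (Real.pi / (2 * N n)) /
      Real.sinc (Real.pi / (2 * N n))) * Real.sin (Real.pi * (y n / N n)))
      atTop (𝓝 (4 / Real.pi)) := by
    have h1 := (Real.continuous_cos.tendsto 0).comp hu
    have h2 := (Real.continuous_sinc.tendsto 0).comp hu
    have h3 := (Real.continuous_sin.tendsto _).comp (hy.const_mul Real.pi)
    rw [Real.cos_zero] at h1
    rw [Real.sinc_zero] at h2
    rw [mul_one_div, Real.sin_pi_div_two] at h3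
    simpa using ((h1.div h2 one_ne_zero).const_mul (4 / Real.pi)).mul h3
  have herr := hNt.add hpiN
  rw [add_zero] at herr
  have hdiff : Tendsto (fun n => spectralSurvival (N n) (t n) (y n) /
      Real.cos (Real.pi / N n) ^ t n - 4 / Real.pi * (Real.cos (Real.pi / (2 * N n)) /
      Real.sinc (Real.pi / (2 * N n))) * Real.sin (Real.pi * (y n / N n))) atTop (𝓝 0) := by
    refine squeeze_zero_norm' ?_ herr
    filter_upwards [hN.eventually_ge_atTop 3] with n hn
    have hn3 : (3 : ℝ) ≤ N n := by exact_mod_cast hn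
    have hn0 : (0 : ℝ) < N n := by linarith
    have hC : 0 < Real.cos (Real.pi / N n) := cos_pi_div_pos hn
    have hCt : 0 < Real.cos (Real.pi / N n) ^ t n := pow_pos hC _
    have h := abs_spectralSurvival_sub_le (N := N n) (by omega) (t n) (y n)
    rw [← div_le_iff₀ hCt] at h
    refine le_trans (le_of_eq ?_) h
    rw [Real.norm_eq_abs, ← abs_of_pos hCt, ← abs_div, abs_of_pos hCt, sub_div,
      mul_div_cancel_right₀ _ hCt.ne', sin_eq_mul_sinc (Real.pi / (2 * N n))]
    congr 2
    field_simp
    ring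
  simpa using hdiff.add hmain

lemma tendsto_mul_cos_pow {N t : ℕ → ℕ} (hN : Tendsto N atTop atTop) {κ : ℝ} (hκ : 0 < κ)
    (ht : ∀ᶠ n in atTop, κ * (N n : ℝ) ^ 3 ≤ t n) :
    Tendsto (fun n => (N n : ℝ) * Real.cos (Real.pi / N n) ^ t n) atTop (𝓝 0) := by
  have hpi := Real.pi_pos
  have hNr : Tendsto (fun n => (N n : ℝ)) atTop atTop := tendsto_natCast_atTop_atTop.comp hN
  have hlim : Tendsto (fun n => (N n : ℝ) * Real.exp (-(2 * κ * N n))) atTop (𝓝 0) := by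
    have h := ((Real.tendsto_pow_mul_exp_neg_atTop_nhds_zero 1).comp
      (hNr.const_mul_atTop (by positivity : 0 < 2 * κ))).const_mul (1 / (2 * κ))
    rw [mul_zero] at h
    refine h.congr fun n => ?_
    simp only [Function.comp_apply, pow_one]
    field_simp
  refine squeeze_zero' ?_ ?_ hlim
  · filter_upwards [hN.eventually_ge_atTop 2] with n hn
    have hC : 0 ≤ Real.cos (Real.pi / N n) := cos_pi_div_nonneg hn
    positivity
  · filter_upwards [hN.eventually_ge_atTop 2, ht] with n hn htn
    have hn2 : (2 : ℝ) ≤ N n := by exact_mod_cast hn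
    have hn0 : (0 : ℝ) < N n := by linarith
    have hC : 0 ≤ Real.cos (Real.pi / N n) := cos_pi_div_nonneg hn
    have hle : Real.cos (Real.pi / N n) ≤ Real.exp (-(2 / (N n : ℝ) ^ 2)) := by
      have h1 : Real.cos (Real.pi / N n) ≤ 1 - 2 / Real.pi ^ 2 * (Real.pi / N n) ^ 2 := by
        apply Real.cos_le_one_sub_mul_cos_sq
        rw [abs_of_nonneg (by positivity)]
        exact div_le_self hpi.le (by linarith)
      have h2 : 2 / Real.pi ^ 2 * (Real.pi / N n) ^ 2 = 2 / (N n : ℝ) ^ 2 := by field_simp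
      have h3 := Real.add_one_le_exp (-(2 / (N n : ℝ) ^ 2))
      linarith
    gcongr
    calc _ ≤ Real.exp (-(2 / (N n : ℝ) ^ 2)) ^ t n := by gcongr
      _ = Real.exp (-(t n * (2 / (N n : ℝ) ^ 2))) := by rw [← Real.exp_nat_mul]; ring_nf
      _ ≤ _ := by
        refine Real.exp_le_exp.2 (neg_le_neg ?_)
        calc 2 * κ * N n = κ * (N n : ℝ) ^ 3 * (2 / (N n : ℝ) ^ 2) := by field_simp
          _ ≤ _ := by gcongr

lemma tendsto_pow_exp_of_tendsto_mul_sub_one {t : ℕ → ℕ} {r : ℕ → ℝ} {L : ℝ}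
    (hr : Tendsto r atTop (𝓝 1)) (h : Tendsto (fun n => t n * (r n - 1)) atTop (𝓝 L)) :
    Tendsto (fun n => r n ^ t n) atTop (𝓝 (Real.exp L)) := by
  have hpos : ∀ᶠ n in atTop, 0 < r n := hr.eventually (lt_mem_nhds one_pos)
  have hlow : Tendsto (fun n => t n * (r n - 1) / r n) atTop (𝓝 L) := by
    have := h.div hr one_ne_zero
    rwa [div_one] at this
  have hlog : Tendsto (fun n => t n * Real.log (r n)) atTop (𝓝 L) := by
    refine tendsto_of_tendsto_of_tendsto_of_le_of_le' hlow h ?_ ?_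
    · filter_upwards [hpos] with n hn
      rw [mul_div_assoc]
      gcongr
      have := Real.one_sub_inv_le_log_of_pos hn
      rwa [sub_div, div_self hn.ne', one_div]
    · filter_upwards [hpos] with n hn
      gcongr
      exact Real.log_le_sub_one_of_pos hn
  refine ((Real.continuous_exp.tendsto L).comp hlog).congr' ?_
  filter_upwards [hpos] with n hn
  rw [Function.comp_apply, Real.exp_nat_mul, Real.exp_log hn]

lemma tendsto_cos_div_cos_pow {t : ℕ → ℕ} {β : ℝ} (s : ℕ)
    (ht : Tendsto (fun n => (t n : ℝ) / (n : ℝ) ^ 3) atTop (𝓝 β)) :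
    Tendsto (fun n => (Real.cos (Real.pi / (n - s : ℕ)) / Real.cos (Real.pi / n)) ^ t n) atTop
      (𝓝 (Real.exp (-(β * Real.pi ^ 2 * s)))) := by
  have hpi := Real.pi_pos
  have hn : Tendsto (fun n : ℕ => (n : ℝ)) atTop atTop := tendsto_natCast_atTop_atTop
  have hm : Tendsto (fun n : ℕ => ((n - s : ℕ) : ℝ)) atTop atTop :=
    tendsto_natCast_atTop_atTop.comp (tendsto_sub_atTop_nat s)
  have hpn : Tendsto (fun n : ℕ => Real.pi / (n : ℝ)) atTop (𝓝 0) := hn.const_div_atTop _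
  have hpm : Tendsto (fun n : ℕ => Real.pi / ((n - s : ℕ) : ℝ)) atTop (𝓝 0) := hm.const_div_atTop _
  have hcn := (Real.continuous_cos.tendsto 0).comp hpn
  have hcm := (Real.continuous_cos.tendsto 0).comp hpm
  rw [Real.cos_zero] at hcn hcm
  have hs := (Real.continuous_sinc.tendsto _).comp ((hpm.add hpn).div_const 2)
  have hd := (Real.continuous_sinc.tendsto _).comp ((hpm.sub hpn).div_const 2)
  rw [add_zero, zero_div, Real.sinc_zero] at hs
  rw [sub_zero, zero_div, Real.sinc_zero] at hd
  have hratio : Tendsto (fun n : ℕ => ((n - s : ℕ) : ℝ) / n) atTop (𝓝 1) := by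
    have h : Tendsto (fun n : ℕ => 1 - (s : ℝ) / n) atTop (𝓝 (1 - 0)) :=
      (hn.const_div_atTop _).const_sub 1
    rw [sub_zero] at h
    refine h.congr' ?_
    filter_upwards [eventually_ge_atTop s, eventually_gt_atTop 0] with n hns hn0
    have : (0 : ℝ) < n := by positivity
    rw [Nat.cast_sub hns, sub_div, div_self this.ne']
  apply tendsto_pow_exp_of_tendsto_mul_sub_one
  · have := hcm.div hcn one_ne_zero
    rwa [div_one] at this
  · have hlim := (((((ht.const_mul (-(Real.pi ^ 2 * s / 2))).mul
      ((hratio.const_add 1).div (hratio.pow 2) (by norm_num))).mul hs).mul hd).div hcn one_ne_zero)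
    have hL : -(Real.pi ^ 2 * s / 2) * β * ((1 + 1) / 1 ^ 2) * 1 * 1 / 1 =
        -(β * Real.pi ^ 2 * s) := by ring
    rw [hL] at hlim
    refine hlim.congr' ?_
    filter_upwards [eventually_gt_atTop s, hcn.eventually (lt_mem_nhds one_pos)] with n hns hC
    simp only [Function.comp_apply, Pi.div_apply] at hC ⊢
    have hn0 : (0 : ℝ) < n := by exact_mod_cast (by omega : 0 < n)
    have hm0 : (0 : ℝ) < ((n - s : ℕ) : ℝ) := by exact_mod_cast (by omega : 0 < n - s)
    have hsm : (s : ℝ) = n - ((n - s : ℕ) : ℝ) := by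
      rw [Nat.cast_sub hns.le]
      ring
    have hg : Real.cos (Real.pi / (n - s : ℕ)) / Real.cos (Real.pi / n) - 1 =
        (Real.cos (Real.pi / (n - s : ℕ)) - Real.cos (Real.pi / n)) / Real.cos (Real.pi / n) := by
      rw [sub_div, div_self hC.ne']
    rw [hg, Real.cos_sub_cos, sin_eq_mul_sinc ((_ + _) / 2), sin_eq_mul_sinc ((_ - _) / 2), hsm]
    generalize Real.sinc _ = A
    generalize Real.sinc _ = B
    generalize Real.cos _ = C at hC ⊢
    generalize ((n - s : ℕ) : ℝ) = m at hm0 ⊢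
    field_simp

/-- fix `α > 0` and positive integers `a`, `b`; set
`t_n = ⌊α n³/(2π²)⌋` and `x_n = ⌊n/2⌋`.  For the random walk on the ring graph
with `n` sites started at `x_n` and conditioned not to hit the origin up to
time `t_n` (identified with the simple random walk on `ℤ` conditioned on
`τ_{{0,n}} > t_n`, the ring site `-a` corresponding to `n - a`), the
probability that the interval `[-a, b]` stays vacant up to time `t_n`,
namely `P_{x_n}[τ_{{b, n-a}} > t_n ∣ τ_{{0,n}} > t_n]`, converges to
`exp(-α(a+b)/2)`, the law of the vacant set of one-dimensional random
interlacements at level `α`. -/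
theorem ring_vacant_set_converges_to_interlacement
    {Ω : Type*} [MeasurableSpace Ω] (P : ℤ → Measure Ω) (S : ℕ → Ω → ℤ)
    (hS : IsSRW P S) (α : ℝ) (hα : 0 < α) (a b : ℕ) (ha : 1 ≤ a) (hb : 1 ≤ b) :
    Tendsto
      (fun n : ℕ =>
        (ProbabilityTheory.cond (P ((n / 2 : ℕ) : ℤ))
            {ω | ∀ s ≤ ⌊α * (n : ℝ) ^ 3 / (2 * Real.pi ^ 2)⌋₊,
              S s ω ∉ ({0, (n : ℤ)} : Set ℤ)}
            {ω | ∀ s ≤ ⌊α * (n : ℝ) ^ 3 / (2 * Real.pi ^ 2)⌋₊,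
              S s ω ∉ ({(b : ℤ), (n : ℤ) - (a : ℤ)} : Set ℤ)}).toReal)
      atTop (𝓝 (Real.exp (-α * ((a : ℝ) + b) / 2))) := by
  have hpi := Real.pi_pos
  set t : ℕ → ℕ := fun n => ⌊α * (n : ℝ) ^ 3 / (2 * Real.pi ^ 2)⌋₊ with ht_def
  have hcube : Tendsto (fun n : ℕ => (n : ℝ) ^ 3) atTop atTop :=
    (tendsto_pow_atTop (by norm_num)).comp tendsto_natCast_atTop_atTop
  have ht : Tendsto (fun n => (t n : ℝ) / (n : ℝ) ^ 3) atTop (𝓝 (α / (2 * Real.pi ^ 2))) := by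
    refine ((tendsto_nat_floor_mul_div_atTop (by positivity :
      0 ≤ α / (2 * Real.pi ^ 2))).comp hcube).congr fun n => ?_
    simp only [Function.comp_apply, ht_def]
    rw [div_mul_eq_mul_div]
  have hκ : 0 < α / (4 * Real.pi ^ 2) := by positivity
  have htlow : ∀ᶠ n : ℕ in atTop, α / (4 * Real.pi ^ 2) * (n : ℝ) ^ 3 ≤ t n := by
    have hlt : α / (4 * Real.pi ^ 2) < α / (2 * Real.pi ^ 2) := by
      apply div_lt_div_of_pos_left hα (by positivity)
      have : 0 < Real.pi ^ 2 := by positivity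
      linarith
    filter_upwards [ht.eventually (lt_mem_nhds hlt), eventually_gt_atTop 0] with n hn hn0
    have : (0 : ℝ) < (n : ℝ) ^ 3 := by positivity
    rw [lt_div_iff₀ this] at hn
    exact hn.le
  have hm : Tendsto (fun n => n - (a + b)) atTop atTop := tendsto_sub_atTop_nat (a + b)
  have htlow' : ∀ᶠ n : ℕ in atTop,
      α / (4 * Real.pi ^ 2) * ((n - (a + b) : ℕ) : ℝ) ^ 3 ≤ t n := by
    filter_upwards [htlow] with n hn
    refine le_trans ?_ hn
    gcongr
    omega
  have hx : Tendsto (fun n : ℕ => (((n / 2 : ℕ) : ℤ) : ℝ) / (n : ℕ)) atTop (𝓝 (1 / 2)) := by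
    have h := (tendsto_nat_floor_mul_div_atTop (by norm_num : (0 : ℝ) ≤ 1 / 2)).comp
      (tendsto_natCast_atTop_atTop (R := ℝ))
    refine h.congr fun n => ?_
    have : ⌊1 / 2 * (n : ℝ)⌋₊ = n / 2 := by
      rw [one_div, inv_mul_eq_div]
      exact_mod_cast Nat.floor_div_eq_div (K := ℝ) n 2
    simp only [Function.comp_apply, this, Int.cast_natCast]
  have hx' : Tendsto (fun n : ℕ => ((((n / 2 : ℕ) : ℤ) - (b : ℤ) : ℤ) : ℝ) / (n - (a + b) : ℕ))
      atTop (𝓝 (1 / 2)) := by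
    have hn := tendsto_natCast_atTop_atTop (R := ℝ)
    have h1 := (hx.sub (hn.const_div_atTop (b : ℝ))).div
      ((hn.const_div_atTop ((a : ℝ) + b)).const_sub 1) (by norm_num)
    rw [sub_zero, sub_zero, div_one] at h1
    refine h1.congr' ?_
    filter_upwards [eventually_gt_atTop (a + b)] with n hn
    have hn0 : (0 : ℝ) < n := by exact_mod_cast (by omega : 0 < n)
    simp only [Pi.div_apply]
    rw [Nat.cast_sub hn.le, ← sub_div, one_sub_div hn0.ne', div_div_div_cancel_right₀ hn0.ne']
    push_cast
    rfl
  have hA := tendsto_spectralSurvival_div (t := t) tendsto_id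
    (tendsto_mul_cos_pow tendsto_id hκ htlow) hx
  have hB := tendsto_spectralSurvival_div (t := t) hm (tendsto_mul_cos_pow hm hκ htlow') hx'
  have hlim := (hB.div hA (by positivity)).mul (tendsto_cos_div_cos_pow (a + b) ht)
  have hL : 4 / Real.pi / (4 / Real.pi) *
      Real.exp (-(α / (2 * Real.pi ^ 2) * Real.pi ^ 2 * ((a + b : ℕ) : ℝ))) =
      Real.exp (-α * ((a : ℝ) + b) / 2) := by
    rw [div_self (by positivity), one_mul]
    congr 1
    push_cast
    field_simp
  rw [hL] at hlim
  refine hlim.congr' ?_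
  filter_upwards [eventually_ge_atTop (2 * (a + b) + 3)] with n hn
  have hmeas : MeasurableSet {ω | ∀ s ≤ t n, S s ω ∉ ({0, (n : ℤ)} : Set ℤ)} := by
    have : {ω | ∀ s ≤ t n, S s ω ∉ ({0, (n : ℤ)} : Set ℤ)} =
        ⋂ s, ⋂ (_ : s ≤ t n), S s ⁻¹' ({0, (n : ℤ)} : Set ℤ)ᶜ := by
      ext ω
      simp
    rw [this]
    exact MeasurableSet.iInter fun s => MeasurableSet.iInter fun _ =>
      hS.2.1 s (Set.to_countable _).measurableSet.compl
  have hinter : {ω | ∀ s ≤ t n, S s ω ∉ ({0, (n : ℤ)} : Set ℤ)} ∩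
      {ω | ∀ s ≤ t n, S s ω ∉ ({(b : ℤ), (n : ℤ) - (a : ℤ)} : Set ℤ)} =
      {ω | ∀ s ≤ t n, S s ω ∈
        (({0, (n : ℤ)} : Set ℤ) ∪ {(b : ℤ), (n : ℤ) - (a : ℤ)})ᶜ} := by
    ext ω
    simp only [Set.mem_inter_iff, Set.mem_ofPred_eq, Set.mem_compl_iff, Set.mem_union, not_or,
      ← forall_and]
  have hPA : P ((n / 2 : ℕ) : ℤ) {ω | ∀ s ≤ t n, S s ω ∉ ({0, (n : ℤ)} : Set ℤ)} =
      ENNReal.ofReal (spectralSurvival n (t n) ((n / 2 : ℕ) : ℤ)) ∧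
      0 ≤ spectralSurvival n (t n) ((n / 2 : ℕ) : ℤ) := by
    have h := stayProb_eq_spectralSurvival (D := ({0, (n : ℤ)} : Set ℤ)ᶜ) (c := 0) (N := n)
      (by omega) (by simp) (by simp) (fun y h1 h2 => by
        simp only [Set.mem_compl_iff, Set.mem_insert_iff, Set.mem_singleton_iff]
        omega) (t n) ((n / 2 : ℕ) : ℤ) (by omega) (by omega)
    rw [← hS.measure_stay, sub_zero] at h
    exact h
  have hPB : P ((n / 2 : ℕ) : ℤ) {ω | ∀ s ≤ t n, S s ω ∈
        (({0, (n : ℤ)} : Set ℤ) ∪ {(b : ℤ), (n : ℤ) - (a : ℤ)})ᶜ} =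
      ENNReal.ofReal (spectralSurvival (n - (a + b)) (t n) (((n / 2 : ℕ) : ℤ) - (b : ℤ))) ∧
      0 ≤ spectralSurvival (n - (a + b)) (t n) (((n / 2 : ℕ) : ℤ) - (b : ℤ)) := by
    have h := stayProb_eq_spectralSurvival
      (D := (({0, (n : ℤ)} : Set ℤ) ∪ {(b : ℤ), (n : ℤ) - (a : ℤ)})ᶜ) (c := b) (N := n - (a + b))
      (by omega) (by simp) (by
        simp only [Set.mem_compl_iff, Set.mem_union, Set.mem_insert_iff, Set.mem_singleton_iff]
        omega) (fun y h1 h2 => by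
        simp only [Set.mem_compl_iff, Set.mem_union, Set.mem_insert_iff, Set.mem_singleton_iff]
        omega) (t n) ((n / 2 : ℕ) : ℤ) (by omega) (by omega)
    rw [← hS.measure_stay] at h
    exact h
  have hCn := pow_pos (cos_pi_div_pos (by omega : 3 ≤ n)) (t n)
  have hCm := pow_pos (cos_pi_div_pos (by omega : 3 ≤ n - (a + b))) (t n)
  rw [ProbabilityTheory.cond_apply hmeas, hinter, hPA.1, hPB.1, ENNReal.toReal_mul,
    ENNReal.toReal_inv, ENNReal.toReal_ofReal hPA.2, ENNReal.toReal_ofReal hPB.2]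
  simp only [Pi.div_apply, id_eq]
  rw [div_pow]
  generalize Real.cos (Real.pi / n) ^ t n = u at hCn ⊢
  generalize Real.cos (Real.pi / (n - (a + b) : ℕ)) ^ t n = v at hCm ⊢
  rw [div_div_div_eq, div_mul_div_comm, inv_mul_eq_div]
  rw [show spectralSurvival (n - (a + b)) (t n) (((n / 2 : ℕ) : ℤ) - (b : ℤ)) * u * v =
    spectralSurvival (n - (a + b)) (t n) (((n / 2 : ℕ) : ℤ) - (b : ℤ)) * (v * u) by ring,
    show v * spectralSurvival n (t n) ((n / 2 : ℕ) : ℤ) * u =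
      spectralSurvival n (t n) ((n / 2 : ℕ) : ℤ) * (v * u) by ring,
    mul_div_mul_right _ _ (by positivity)]
end

section
/- Let (S_t) be the simple random walk on ℤ and let Δ = Δ(n) satisfy liminf_{n→∞} Δ/(n² ln n) ≥ 4/π². Then E_a[ sin(π S_Δ / n) | τ_{{0,n}} > Δ ] = (1 + O(n^{−2})) · π/4, uniformly in a: there exist C > 0 and n₀ such that for all n ≥ n₀ and all integers a with 1 ≤ a ≤ n−1, | E_a[ sin(π S_Δ / n) | τ_{{0,n}} > Δ ] − π/4 | ≤ C n^{−2}. -/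
open MeasureTheory ProbabilityTheory Finset Filter
open scoped ENNReal Topology

section Walk

variable {Ω : Type*} [MeasurableSpace Ω] {P : ℤ → Measure Ω} {S : ℕ → Ω → ℤ}

theorem IsSRW.ae_start (hS : IsSRW P S) (x : ℤ) : ∀ᵐ ω ∂(P x), S 0 ω = x := by
  have := hS.1 x
  have h := hS.2.2 x 0 (fun _ => x) rfl
  simp only [Nat.le_zero, forall_eq, Finset.range_zero, Finset.prod_empty] at h
  have hm : MeasurableSet {ω | S 0 ω = x} := hS.2.1 0 (measurableSet_singleton x)
  exact (prob_compl_eq_zero_iff hm).2 h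

/-- The joint law of the walk up to time `t` and of its position at time `t + 1`. -/
theorem IsSRW.map_step (hS : IsSRW P S) (x : ℤ) (t : ℕ) :
    (P x).map (fun ω => ((fun s : Fin (t + 1) => S s ω), S (t + 1) ω)) =
      (1 / 2 : ℝ≥0∞) • (P x).map (fun ω => ((fun s : Fin (t + 1) => S s ω), S t ω + 1)) +
      (1 / 2 : ℝ≥0∞) • (P x).map (fun ω => ((fun s : Fin (t + 1) => S s ω), S t ω - 1)) := by
  have hSm := hS.2.1
  refine Measure.ext_of_singleton fun ⟨γ, y⟩ => ?_
  rw [Measure.add_apply, Measure.smul_apply, Measure.smul_apply,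
    Measure.map_apply (by fun_prop) (measurableSet_singleton _),
    Measure.map_apply (by fun_prop) (measurableSet_singleton _),
    Measure.map_apply (by fun_prop) (measurableSet_singleton _)]
  by_cases h0 : γ 0 = x
  · set γ' : ℕ → ℤ := fun s => if h : s < t + 1 then γ ⟨s, h⟩ else y with hγ'
    have hpath : ∀ ω, (∀ s ≤ t, S s ω = γ' s) ↔ (fun s : Fin (t + 1) => S s ω) = γ := by
      intro ω
      rw [funext_iff]
      constructor
      · intro h s
        have := h s (by omega)
        simpa [hγ', Nat.le_of_lt_succ s.2] using this
      · intro h s hs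
        have := h ⟨s, by omega⟩
        simpa [hγ', hs] using this
    have hγ0 : γ' 0 = x := by simpa [hγ'] using h0
    have hγt : γ' (t + 1) = y := by simp [hγ']
    have h1 := hS.2.2 x (t + 1) γ' hγ0
    rw [Finset.prod_range_succ, ← hS.2.2 x t γ' hγ0, hγt] at h1
    have e1 : (fun ω => ((fun s : Fin (t + 1) => S s ω), S (t + 1) ω)) ⁻¹' {(γ, y)} =
        {ω | ∀ s ≤ t + 1, S s ω = γ' s} := by
      ext ω
      simp only [Set.mem_preimage, Set.mem_singleton_iff, Prod.mk.injEq, Set.mem_ofPred_eq,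
        ← hpath]
      constructor
      · rintro ⟨h, h'⟩ s hs
        rcases Nat.le_succ_iff.1 hs with hs | rfl
        · exact h s hs
        · rw [h', hγt]
      · intro h
        exact ⟨fun s hs => h s (by omega), by rw [h _ le_rfl, hγt]⟩
    have e2 : ∀ d : ℤ, (P x) ((fun ω => ((fun s : Fin (t + 1) => S s ω), S t ω + d)) ⁻¹'
        {(γ, y)}) = if y = γ' t + d then (P x) {ω | ∀ s ≤ t, S s ω = γ' s} else 0 := by
      intro d
      split_ifs with hy
      · congr 1
        ext ω
        simp only [Set.mem_preimage, Set.mem_singleton_iff, Prod.mk.injEq, Set.mem_ofPred_eq,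
          ← hpath, and_iff_left_iff_imp]
        intro h
        rw [h t le_rfl, hy]
      · convert measure_empty (μ := P x)
        ext ω
        simp only [Set.mem_preimage, Set.mem_singleton_iff, Prod.mk.injEq, ← hpath,
          Set.mem_empty_iff_false, iff_false, not_and]
        intro h h'
        rw [h t le_rfl] at h'
        exact hy h'.symm
    have e3 := e2 (-1)
    simp only [← sub_eq_add_neg] at e3
    rw [e1, h1, e2 1, e3, srwStep]
    by_cases ha : y = γ' t + 1
    · have hb : y ≠ γ' t - 1 := by omega
      rw [if_pos (.inl ha), if_pos ha, if_neg hb, smul_zero, add_zero, smul_eq_mul, mul_comm]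
    · by_cases hb : y = γ' t - 1
      · rw [if_pos (.inr hb), if_pos hb, if_neg ha, smul_zero, zero_add, smul_eq_mul, mul_comm]
      · simp [ha, hb]
  · have hz : ∀ A : Set Ω, (∀ ω ∈ A, S 0 ω = γ 0) → (P x) A = 0 := by
      intro A hA
      refine measure_mono_null (fun ω hω => ?_) (hS.ae_start x)
      intro h
      exact h0 ((hA ω hω).symm.trans h)
    rw [hz, hz, hz]
    · simp
    all_goals
      intro ω hω
      simp only [Set.mem_preimage, Set.mem_singleton_iff, Prod.mk.injEq] at hω
      exact congrFun hω.1 0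

theorem IsSRW.ae_step (hS : IsSRW P S) (x : ℤ) (t : ℕ) :
    ∀ᵐ ω ∂(P x), S (t + 1) ω = S t ω + 1 ∨ S (t + 1) ω = S t ω - 1 := by
  have hSm := hS.2.1
  have key : ∀ᵐ p ∂((P x).map (fun ω => ((fun s : Fin (t + 1) => S s ω), S (t + 1) ω))),
      p.2 = p.1 (Fin.last t) + 1 ∨ p.2 = p.1 (Fin.last t) - 1 := by
    have hm : MeasurableSet {p : (Fin (t + 1) → ℤ) × ℤ |
        p.2 = p.1 (Fin.last t) + 1 ∨ p.2 = p.1 (Fin.last t) - 1} :=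
      (Set.to_countable _).measurableSet
    rw [hS.map_step, ae_add_measure_iff]
    refine ⟨Measure.ae_smul_measure ?_ _, Measure.ae_smul_measure ?_ _⟩ <;>
    · rw [ae_map_iff (by fun_prop) hm]
      simp
  simpa using ae_of_ae_map (by fun_prop) key

theorem integrable_comp_of_abs_le_one {α : Type*} [MeasurableSpace α] {μ : Measure α}
    [IsFiniteMeasure μ] {h : ℤ → ℝ} (hb : ∀ y, |h y| ≤ 1) {g : α → ℤ} (hg : Measurable g) :
    Integrable (fun p => h (g p)) μ :=
  Integrable.of_bound ((measurable_of_countable h).comp hg).aestronglyMeasurable 1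
    (Eventually.of_forall fun p => by simpa using hb (g p))

/-- A one step Markov property for the walk killed on leaving `D`. -/
theorem IsSRW.setIntegral_step (hS : IsSRW P S) (x : ℤ) (t : ℕ) (D : Set ℤ) (h : ℤ → ℝ)
    (hb : ∀ y, |h y| ≤ 1) :
    ∫ ω in {ω | ∀ s ≤ t, S s ω ∈ D}, h (S (t + 1) ω) ∂(P x) =
      ∫ ω in {ω | ∀ s ≤ t, S s ω ∈ D}, (h (S t ω + 1) + h (S t ω - 1)) / 2 ∂(P x) := by
  have hSm := hS.2.1
  have := hS.1 x
  set V : Set ((Fin (t + 1) → ℤ) × ℤ) := {p | ∀ s, p.1 s ∈ D} with hV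
  have hVm : MeasurableSet V := (Set.to_countable _).measurableSet
  have hpre : ∀ g : Ω → ℤ, {ω | ∀ s ≤ t, S s ω ∈ D} =
      (fun ω => ((fun s : Fin (t + 1) => S s ω), g ω)) ⁻¹' V := by
    intro g
    ext ω
    simp only [hV, Set.mem_ofPred_eq, Set.mem_preimage]
    exact ⟨fun H s => H s (by omega), fun H s hs => H ⟨s, by omega⟩⟩
  have hmap : ∀ g : Ω → ℤ, Measurable g →
      ∫ ω in {ω | ∀ s ≤ t, S s ω ∈ D}, h (g ω) ∂(P x) =
      ∫ p in V, h p.2 ∂((P x).map (fun ω => ((fun s : Fin (t + 1) => S s ω), g ω))) := by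
    intro g hg
    rw [hpre g, setIntegral_map hVm (measurable_of_countable _).aestronglyMeasurable
      (by fun_prop)]
  rw [hmap _ (hSm (t + 1)), hS.map_step, Measure.restrict_add, Measure.restrict_smul,
    Measure.restrict_smul, integral_add_measure, integral_smul_measure, integral_smul_measure,
    ← hmap _ (by fun_prop), ← hmap _ (by fun_prop), integral_div, integral_add]
  · simp
    ring
  · exact integrable_comp_of_abs_le_one hb (by fun_prop)
  · exact integrable_comp_of_abs_le_one hb (by fun_prop)
  · exact (integrable_comp_of_abs_le_one hb measurable_snd).smul_measure (c := 1 / 2) (by simp)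
  · exact (integrable_comp_of_abs_le_one hb measurable_snd).smul_measure (c := 1 / 2) (by simp)

/-- Eigenfunctions of the killed walk. -/
theorem IsSRW.setIntegral_eigen (hS : IsSRW P S) {x : ℤ} {D : Set ℤ} (hx : x ∈ D) {h : ℤ → ℝ}
    (hb : ∀ y, |h y| ≤ 1) (h0 : ∀ y ∉ D, h y = 0) {c : ℝ}
    (hc : ∀ y, (h (y + 1) + h (y - 1)) / 2 = c * h y) (t : ℕ) :
    ∫ ω in {ω | ∀ s ≤ t, S s ω ∈ D}, h (S t ω) ∂(P x) = c ^ t * h x := by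
  have := hS.1 x
  have hm : ∀ t, MeasurableSet {ω | ∀ s ≤ t, S s ω ∈ D} := fun t => by
    have : {ω | ∀ s ≤ t, S s ω ∈ D} = ⋂ s, ⋂ (_ : s ≤ t), S s ⁻¹' D := by ext; simp
    rw [this]
    exact .iInter fun s => .iInter fun _ => hS.2.1 s (Set.to_countable D).measurableSet
  induction t with
  | zero =>
    have h1 : ∀ᵐ ω ∂(P x), ω ∈ {ω | ∀ s ≤ 0, S s ω ∈ D} := by
      filter_upwards [hS.ae_start x] with ω hω
      simp [hω, hx]
    rw [Measure.restrict_eq_self_of_ae_mem h1, integral_congr_ae (g := fun _ => h x)]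
    · simp
    · filter_upwards [hS.ae_start x] with ω hω
      rw [hω]
  | succ t ih =>
    have h1 : ∫ ω in {ω | ∀ s ≤ t + 1, S s ω ∈ D}, h (S (t + 1) ω) ∂(P x) =
        ∫ ω in {ω | ∀ s ≤ t, S s ω ∈ D}, h (S (t + 1) ω) ∂(P x) := by
      refine (setIntegral_eq_of_subset_of_forall_sdiff_eq_zero (hm t)
        (fun ω (hω : ∀ s ≤ t + 1, S s ω ∈ D) s hs => hω s (by omega)) fun ω hω => h0 _ fun hD => hω.2 fun s hs => ?_).symm
      rcases Nat.le_succ_iff.1 hs with hs | rfl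
      · exact hω.1 s hs
      · exact hD
    rw [h1, hS.setIntegral_step x t D h hb]
    simp_rw [hc]
    rw [integral_const_mul, ih]
    ring

/-- The walk cannot jump over the endpoints of an interval. -/
theorem IsSRW.ae_mem_Ioo (hS : IsSRW P S) {x n : ℤ} (hx : x ∈ Set.Ioo 0 n) (t : ℕ) :
    ∀ᵐ ω ∂(P x), (∀ s ≤ t, S s ω ∉ ({0, n} : Set ℤ)) → S t ω ∈ Set.Ioo 0 n := by
  filter_upwards [hS.ae_start x, ae_all_iff.2 (hS.ae_step x)] with ω h0 hstep
  intro hω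
  induction t with
  | zero => rwa [h0]
  | succ t ih =>
    have h1 := ih fun s hs => hω s (by omega)
    have h2 := hω (t + 1) le_rfl
    simp only [Set.mem_insert_iff, Set.mem_singleton_iff, Set.mem_Ioo] at *
    have := hstep t
    omega

end Walk

section Trigonometry

theorem sum_cos_odd_mul_eq_zero {n m : ℕ} (hm : 0 < m) (hmn : m < n) :
    ∑ j ∈ range n, Real.cos ((2 * j + 1) * (Real.pi / n) * m) = 0 := by
  have hn : (0 : ℝ) < n := by exact_mod_cast hm.trans hmn
  set x : ℝ := Real.pi / n * m with hx
  have hxpos : 0 < Real.sin x := by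
    apply Real.sin_pos_of_pos_of_lt_pi
    · have : (0 : ℝ) < m := by exact_mod_cast hm
      positivity
    · have h1 : (m : ℝ) < n := by exact_mod_cast hmn
      rw [hx, div_mul_eq_mul_div, div_lt_iff₀ hn]
      exact mul_lt_mul_of_pos_left h1 Real.pi_pos
  have h : ∀ N : ℕ, (∑ j ∈ range N, Real.cos ((2 * j + 1) * (Real.pi / n) * m)) *
      (2 * Real.sin x) = Real.sin (2 * N * x) := by
    intro N
    induction N with
    | zero => simp
    | succ N ih =>
      rw [sum_range_succ, add_mul, ih]
      have e1 : (2 * (N : ℝ) + 1) * (Real.pi / n) * m = 2 * N * x + x := by rw [hx]; ring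
      have e2 : 2 * ((N + 1 : ℕ) : ℝ) * x = (2 * N * x + x) + x := by push_cast; ring
      have e3 : 2 * (N : ℝ) * x = (2 * N * x + x) - x := by ring
      rw [e1, e2]
      conv_lhs => rw [e3]
      rw [sub_add_cancel, Real.sin_add, Real.sin_sub]
      ring
  have h2 := h n
  have e : 2 * (n : ℝ) * x = ((2 * m : ℕ) : ℝ) * Real.pi := by
    rw [hx]; push_cast; field_simp
  rw [e, Real.sin_nat_mul_pi] at h2
  exact (mul_eq_zero.1 h2).resolve_right (by positivity)

theorem one_div_le_sin {n : ℕ} {x : ℝ} (hn : 0 < n) (h1 : Real.pi / n / 2 ≤ x)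
    (h2 : x ≤ Real.pi - Real.pi / n / 2) : 1 / (n : ℝ) ≤ Real.sin x := by
  have hn' : (0 : ℝ) < n := by exact_mod_cast hn
  have hpi := Real.pi_pos
  have key : ∀ y, Real.pi / n / 2 ≤ y → y ≤ Real.pi / 2 → 1 / (n : ℝ) ≤ Real.sin y := by
    intro y hy hy'
    calc 1 / (n : ℝ) = 2 / Real.pi * (Real.pi / n / 2) := by field_simp
      _ ≤ 2 / Real.pi * y := by gcongr
      _ ≤ Real.sin y := Real.mul_le_sin (le_trans (by positivity) hy) hy'
  rcases le_total x (Real.pi / 2) with h | h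
  · exact key x h1 h
  · rw [← Real.sin_pi_sub]
    exact key _ (by linarith) (by linarith)

theorem odd_mul_half_mem {n j : ℕ} (hj : j < n) :
    Real.pi / n / 2 ≤ (2 * j + 1) * (Real.pi / n) / 2 ∧
      (2 * j + 1) * (Real.pi / n) / 2 ≤ Real.pi - Real.pi / n / 2 := by
  have hn : (0 : ℝ) < n := by exact_mod_cast (Nat.zero_le j).trans_lt hj
  have hj' : (j : ℝ) + 1 ≤ n := by exact_mod_cast hj
  have hpi := Real.pi_pos
  have ht : 0 < Real.pi / n := by positivity
  have hnt : n * (Real.pi / n) = Real.pi := by field_simp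
  have hj0 : (0 : ℝ) ≤ j := j.cast_nonneg
  constructor <;> nlinarith

/-- Expansion of the constant function on `{1, …, n - 1}` in sine modes. -/
theorem sum_cot_mul_sin {n m : ℕ} (hm : 0 < m) (hmn : m < n) :
    ∑ j ∈ range n, Real.cos ((2 * j + 1) * (Real.pi / n) / 2) /
      Real.sin ((2 * j + 1) * (Real.pi / n) / 2) *
        Real.sin ((2 * j + 1) * (Real.pi / n) * m) = n := by
  have step : ∀ m : ℕ, ∑ j ∈ range n, Real.cos ((2 * j + 1) * (Real.pi / n) / 2) /
      Real.sin ((2 * j + 1) * (Real.pi / n) / 2) *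
        Real.sin ((2 * j + 1) * (Real.pi / n) * (m + 1 : ℕ)) =
      ∑ j ∈ range n, Real.cos ((2 * j + 1) * (Real.pi / n) / 2) /
      Real.sin ((2 * j + 1) * (Real.pi / n) / 2) *
        Real.sin ((2 * j + 1) * (Real.pi / n) * m) +
      (∑ j ∈ range n, Real.cos ((2 * j + 1) * (Real.pi / n) * (m + 1 : ℕ)) +
      ∑ j ∈ range n, Real.cos ((2 * j + 1) * (Real.pi / n) * m)) := by
    intro m
    rw [← sum_add_distrib, ← sum_add_distrib]
    refine sum_congr rfl fun j hj => ?_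
    have hj := mem_range.1 hj
    obtain ⟨h1, h2⟩ := odd_mul_half_mem hj
    have hs := one_div_le_sin (by omega) h1 h2
    have hn : (0 : ℝ) < n := by exact_mod_cast (Nat.zero_le j).trans_lt hj
    set x := (2 * (j : ℝ) + 1) * (Real.pi / n) / 2 with hx
    have hs0 : Real.sin x ≠ 0 := (lt_of_lt_of_le (by positivity) hs).ne'
    obtain ⟨y, hy⟩ : ∃ y, y = (2 * (j : ℝ) + 1) * (Real.pi / n) * m + x := ⟨_, rfl⟩
    have e1 : (2 * (j : ℝ) + 1) * (Real.pi / n) * (m + 1 : ℕ) = y + x := by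
      rw [hy, hx]; push_cast; ring
    have e2 : (2 * (j : ℝ) + 1) * (Real.pi / n) * m = y - x := by rw [hy]; ring
    rw [e1, e2, Real.sin_add, Real.sin_sub, Real.cos_add, Real.cos_sub]
    field_simp
    ring
  induction m with
  | zero => omega
  | succ m ih =>
    rw [step]
    rcases Nat.eq_zero_or_pos m with rfl | h
    · rw [sum_cos_odd_mul_eq_zero hm hmn]
      simp
    · rw [ih h (by omega), sum_cos_odd_mul_eq_zero hm hmn, sum_cos_odd_mul_eq_zero h (by omega)]
      simp

theorem abs_sin_nat_mul_le (k : ℕ) (x : ℝ) : |Real.sin (k * x)| ≤ k * |Real.sin x| := by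
  induction k with
  | zero => simp
  | succ k ih =>
    have e : ((k + 1 : ℕ) : ℝ) * x = k * x + x := by push_cast; ring
    rw [e, Real.sin_add]
    calc _ ≤ |Real.sin (k * x) * Real.cos x| + |Real.cos (k * x) * Real.sin x| := abs_add_le _ _
      _ ≤ |Real.sin (k * x)| * 1 + 1 * |Real.sin x| := by
        rw [abs_mul, abs_mul]
        gcongr
        · exact Real.abs_cos_le_one x
        · exact Real.abs_cos_le_one _
      _ ≤ _ := by push_cast; linarith

theorem abs_cos_le_cos_s14 {x y : ℝ} (hy : 0 ≤ y) (h1 : y ≤ x) (h2 : x ≤ Real.pi - y) :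
    |Real.cos x| ≤ Real.cos y := by
  rw [abs_le]
  constructor
  · rw [← Real.cos_pi_sub]
    exact Real.cos_le_cos_of_nonneg_of_le_pi (by linarith) (by linarith) h2
  · exact Real.cos_le_cos_of_nonneg_of_le_pi hy (by linarith) h1

/-- The sine modes other than the lowest one and its mirror image are negligible. -/
theorem abs_mode_le {n j a t : ℕ} (hn : 10 ≤ n) (hj : j < n) (hj0 : j ≠ 0) (hj1 : j ≠ n - 1)
    (ha : 0 < a) (han : a < n) :
    |Real.cos ((2 * j + 1) * (Real.pi / n) / 2) / Real.sin ((2 * j + 1) * (Real.pi / n) / 2) *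
      (Real.cos ((2 * j + 1) * (Real.pi / n)) ^ t * Real.sin ((2 * j + 1) * (Real.pi / n) * a))| ≤
    Real.cos (Real.pi / n) ^ t * Real.sin (Real.pi / n * a) *
      ((if j = n / 2 then 4 / (n : ℝ) else 0) + (if j = n / 2 - 1 then 4 / (n : ℝ) else 0) +
        2 * n ^ 2 * (Real.cos (2 * (Real.pi / n)) / Real.cos (Real.pi / n)) ^ t) := by
  have hn' : (10 : ℝ) ≤ n := by exact_mod_cast hn
  have hn0 : (0 : ℝ) < n := by linarith
  have hpi := Real.pi_pos
  have hpi4 := Real.pi_lt_four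
  obtain ⟨h1, h2⟩ := odd_mul_half_mem hj
  have hs := one_div_le_sin (by omega) h1 h2
  set θ := Real.pi / n with hθ
  have hnt : n * θ = Real.pi := by rw [hθ]; field_simp
  have hθ0 : 0 < θ := by positivity
  have hcos : 0 < Real.cos θ := Real.cos_pos_of_mem_Ioo ⟨by linarith, by nlinarith⟩
  have hcos2 : 0 < Real.cos (2 * θ) := Real.cos_pos_of_mem_Ioo ⟨by linarith, by nlinarith⟩
  have ha0 : (0 : ℝ) < a := by exact_mod_cast ha
  have han' : (a : ℝ) < n := by exact_mod_cast han
  have hsin : 0 < Real.sin (θ * a) :=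
    Real.sin_pos_of_pos_of_lt_pi (by positivity) (by nlinarith)
  set x := (2 * (j : ℝ) + 1) * θ / 2 with hx
  have hsx : 0 < Real.sin x := lt_of_lt_of_le (by positivity) hs
  have hr : 0 ≤ 2 * (n : ℝ) ^ 2 * (Real.cos (2 * θ) / Real.cos θ) ^ t := by positivity
  have hB : 0 < Real.cos θ ^ t * Real.sin (θ * a) := by positivity
  have hif : ∀ p : Prop, [Decidable p] → (0 : ℝ) ≤ if p then 4 / (n : ℝ) else 0 := by
    intro p _; split_ifs <;> positivity
  rw [abs_mul, abs_mul, abs_div, abs_of_pos hsx, abs_pow]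
  have hi1 := hif (j = n / 2)
  have hi2 := hif (j = n / 2 - 1)
  have hjn : (j : ℝ) + 1 ≤ n := by exact_mod_cast hj
  -- the two modes next to the middle
  have near : ∀ ε : ℝ, |ε| = 1 → x = Real.pi / 2 + ε * (θ / 2) →
      |Real.cos x| / Real.sin x * (|Real.cos ((2 * j + 1) * θ)| ^ t *
        |Real.sin ((2 * j + 1) * θ * a)|) ≤ Real.cos θ ^ t * Real.sin (θ * a) * (4 / n) := by
    intro ε hε hxε
    have hε' : ε = 1 ∨ ε = -1 := eq_or_eq_neg_of_abs_eq hε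
    have e0 : (2 * (j : ℝ) + 1) * θ = ε * θ + Real.pi := by rw [hx] at hxε; linarith
    have e1 : |Real.cos ((2 * j + 1) * θ)| = Real.cos θ := by
      rw [e0, Real.cos_add_pi, abs_neg]
      rcases hε' with rfl | rfl <;> simp [abs_of_pos hcos]
    have e2 : |Real.sin ((2 * j + 1) * θ * a)| = Real.sin (θ * a) := by
      have : (2 * (j : ℝ) + 1) * θ * a = ε * (θ * a) + a * Real.pi := by rw [e0]; ring
      rw [this, Real.sin_add_nat_mul_pi, abs_mul, abs_pow, abs_neg, abs_one, one_pow, one_mul]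
      rcases hε' with rfl | rfl <;> simp [abs_of_pos hsin]
    have e3 : |Real.cos x| ≤ 2 / n := by
      have : Real.cos x = - Real.sin (ε * (θ / 2)) := by
        rw [hxε, add_comm, Real.cos_add_pi_div_two]
      rw [this, abs_neg]
      refine (Real.abs_sin_le_abs).trans ?_
      rw [abs_mul, hε, one_mul, abs_of_pos (by positivity), hθ, div_div,
        div_le_div_iff₀ (by positivity) hn0]
      nlinarith
    have e4 : 1 / 2 ≤ Real.sin x := by
      have : Real.sin x = Real.cos (θ / 2) := by
        rw [hxε, add_comm, Real.sin_add_pi_div_two]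
        rcases hε' with rfl | rfl <;> simp
      rw [this]
      have := Real.one_sub_sq_div_two_le_cos (x := θ / 2)
      have : θ ≤ 1 / 2 := by nlinarith
      nlinarith
    rw [e1, e2, mul_comm]
    refine mul_le_mul_of_nonneg_left ?_ hB.le
    rw [div_le_iff₀ hsx]
    calc |Real.cos x| ≤ 2 / n := e3
      _ = 4 / n * (1 / 2) := by ring
      _ ≤ _ := by gcongr
  rcases eq_or_ne (2 * j + 1) n with hc | hc
  · have : x = Real.pi / 2 := by
      rw [hx, ← hnt, ← hc]; push_cast; ring
    rw [this]
    simp only [Real.cos_pi_div_two, abs_zero, zero_div, zero_mul]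
    positivity
  rcases eq_or_ne (2 * j + 1) (n + 1) with hp | hp
  · refine (near 1 (by simp) ?_).trans ?_
    · have : (2 * (j : ℝ) + 1) = n + 1 := by exact_mod_cast hp
      rw [hx, ← hnt, this]; ring
    · rw [if_pos (show j = n / 2 by omega)]
      gcongr
      linarith
  rcases eq_or_ne (2 * j + 1 + 1) n with hq | hq
  · refine (near (-1) (by simp) ?_).trans ?_
    · have : (2 * (j : ℝ) + 1) + 1 = n := by exact_mod_cast hq
      rw [hx, ← hnt, ← this]; ring
    · rw [if_pos (show j = n / 2 - 1 by omega)]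
      gcongr
      linarith
  have c1 : |Real.cos x| / Real.sin x ≤ n := by
    rw [div_le_iff₀ hsx]
    calc |Real.cos x| ≤ 1 := Real.abs_cos_le_one x
      _ = n * (1 / n) := by field_simp
      _ ≤ _ := by gcongr
  have c2 : |Real.cos ((2 * j + 1) * θ)| ≤ Real.cos (2 * θ) := by
    have b1 : (1 : ℝ) ≤ j := by exact_mod_cast Nat.one_le_iff_ne_zero.2 hj0
    have b2 : (j : ℝ) + 2 ≤ n := by exact_mod_cast (show j + 2 ≤ n by omega)
    have d1 := mul_le_mul_of_nonneg_right b1 hθ0.le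
    have d2 := mul_le_mul_of_nonneg_right b2 hθ0.le
    rcases lt_or_gt_of_ne hc with h | h
    · have b3 : 2 * (j : ℝ) + 1 + 2 ≤ n := by exact_mod_cast (show 2 * j + 1 + 2 ≤ n by omega)
      have d3 := mul_le_mul_of_nonneg_right b3 hθ0.le
      exact abs_cos_le_cos_s14 (by positivity) (by linarith) (by linarith)
    · have b3 : (n : ℝ) + 2 ≤ 2 * (j : ℝ) + 1 := by
        exact_mod_cast (show n + 2 ≤ 2 * j + 1 by omega)
      have d3 := mul_le_mul_of_nonneg_right b3 hθ0.le
      rw [← abs_neg, ← Real.cos_sub_pi]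
      exact abs_cos_le_cos_s14 (by positivity) (by linarith) (by linarith)
  have c3 : |Real.sin ((2 * j + 1) * θ * a)| ≤ 2 * n * Real.sin (θ * a) := by
    have := abs_sin_nat_mul_le (2 * j + 1) (θ * a)
    rw [abs_of_pos hsin] at this
    push_cast at this
    rw [mul_assoc]
    refine this.trans ?_
    gcongr
    linarith
  calc _ ≤ (n : ℝ) * (Real.cos (2 * θ) ^ t * (2 * n * Real.sin (θ * a))) := by gcongr
    _ = Real.cos θ ^ t * Real.sin (θ * a) *
        (2 * n ^ 2 * (Real.cos (2 * θ) / Real.cos θ) ^ t) := by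
      rw [div_pow]; field_simp
    _ ≤ _ := by
      gcongr
      linarith

theorem abs_sum_modes_sub_le {n a t : ℕ} (hn : 10 ≤ n) (ha : 0 < a) (han : a < n) :
    |∑ j ∈ range n, Real.cos ((2 * j + 1) * (Real.pi / n) / 2) /
      Real.sin ((2 * j + 1) * (Real.pi / n) / 2) *
      (Real.cos ((2 * j + 1) * (Real.pi / n)) ^ t * Real.sin ((2 * j + 1) * (Real.pi / n) * a)) -
      Real.cos (Real.pi / n) ^ t * Real.sin (Real.pi / n * a) *
        (2 * (Real.cos (Real.pi / n / 2) / Real.sin (Real.pi / n / 2)))| ≤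
    Real.cos (Real.pi / n) ^ t * Real.sin (Real.pi / n * a) *
      (8 / n + 2 * n ^ 3 * (Real.cos (2 * (Real.pi / n)) / Real.cos (Real.pi / n)) ^ t) := by
  have hn' : (10 : ℝ) ≤ n := by exact_mod_cast hn
  have hn0 : (0 : ℝ) < n := by linarith
  have hpi := Real.pi_pos
  set q : ℕ → ℝ := fun j => Real.cos ((2 * j + 1) * (Real.pi / n) / 2) /
      Real.sin ((2 * j + 1) * (Real.pi / n) / 2) *
      (Real.cos ((2 * j + 1) * (Real.pi / n)) ^ t *
        Real.sin ((2 * j + 1) * (Real.pi / n) * a)) with hq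
  have hmode : ∀ j < n, j ≠ 0 → j ≠ n - 1 → |q j| ≤ _ := fun j hj h0 h1 =>
    abs_mode_le (t := t) hn hj h0 h1 ha han
  set θ := Real.pi / n with hθ
  have hnt : n * θ = Real.pi := by rw [hθ]; field_simp
  have hθ0 : 0 < θ := by positivity
  have hcos : 0 < Real.cos θ := Real.cos_pos_of_mem_Ioo ⟨by linarith, by nlinarith⟩
  have hcos2 : 0 < Real.cos (2 * θ) := Real.cos_pos_of_mem_Ioo ⟨by linarith, by nlinarith⟩
  have ha0 : (0 : ℝ) < a := by exact_mod_cast ha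
  have han' : (a : ℝ) < n := by exact_mod_cast han
  have hsin : 0 < Real.sin (θ * a) :=
    Real.sin_pos_of_pos_of_lt_pi (by positivity) (by nlinarith)
  set B := Real.cos θ ^ t * Real.sin (θ * a) with hBdef
  have hB : 0 < B := by positivity
  set M := Real.cos (θ / 2) / Real.sin (θ / 2) with hM
  set R := (Real.cos (2 * θ) / Real.cos θ) ^ t with hR
  have hR0 : 0 ≤ R := by positivity
  have q0 : q 0 = B * M := by simp [hq, hM, hBdef, mul_comm]
  have q1 : q (n - 1) = B * M := by
    have e : 2 * (((n - 1 : ℕ)) : ℝ) + 1 = 2 * n - 1 := by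
      rw [Nat.cast_sub (by omega)]; push_cast; ring
    have e1 : (2 * (n : ℝ) - 1) * θ / 2 = Real.pi - θ / 2 := by rw [← hnt]; ring
    have e2 : (2 * (n : ℝ) - 1) * θ = 2 * Real.pi - θ := by rw [← hnt]; ring
    have e3 : (2 * (n : ℝ) - 1) * θ * a = a * (2 * Real.pi) - θ * a := by rw [e2]; ring
    simp only [hq, e]
    rw [e1, e3, e2, Real.cos_pi_sub, Real.sin_pi_sub, Real.cos_two_pi_sub,
      Real.sin_nat_mul_two_pi_sub, hM, hBdef]
    ring
  have hsum : ∑ j ∈ range n, q j - B * (2 * M) =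
      ∑ j ∈ range n, (q j - (if j = 0 then B * M else 0) - (if j = n - 1 then B * M else 0)) := by
    rw [sum_sub_distrib, sum_sub_distrib, sum_ite_eq', sum_ite_eq',
      if_pos (mem_range.2 (by omega)), if_pos (mem_range.2 (by omega))]
    ring
  rw [hsum]
  have hif : ∀ p : Prop, [Decidable p] → (0 : ℝ) ≤ if p then 4 / (n : ℝ) else 0 := by
    intro p _; split_ifs <;> positivity
  calc _ ≤ ∑ j ∈ range n, |q j - (if j = 0 then B * M else 0) -
          (if j = n - 1 then B * M else 0)| := abs_sum_le_sum_abs _ _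
    _ ≤ ∑ j ∈ range n, B * ((if j = n / 2 then 4 / (n : ℝ) else 0) +
          (if j = n / 2 - 1 then 4 / (n : ℝ) else 0) + 2 * n ^ 2 * R) := by
      refine sum_le_sum fun j hj => ?_
      have hj := mem_range.1 hj
      have hi1 := hif (j = n / 2)
      have hi2 := hif (j = n / 2 - 1)
      by_cases h0 : j = 0
      · rw [if_pos h0, if_neg (show j ≠ n - 1 by omega), h0, q0]
        rw [h0] at hi1 hi2
        simp only [sub_self, abs_zero]
        positivity
      by_cases h1 : j = n - 1
      · rw [if_neg h0, if_pos h1]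
        rw [h1] at hi1 hi2 ⊢
        rw [q1]
        simp only [sub_self, sub_zero, abs_zero]
        positivity
      rw [if_neg h0, if_neg h1, sub_zero, sub_zero]
      exact hmode j hj h0 h1
    _ = _ := by
      rw [← mul_sum, sum_add_distrib, sum_add_distrib, sum_ite_eq', sum_ite_eq',
        if_pos (mem_range.2 (by omega)), if_pos (mem_range.2 (by omega)), sum_const, card_range,
        nsmul_eq_mul]
      ring

theorem cos_two_mul_div_cos_pow_le {n t : ℕ} (hn : 12 ≤ n)
    (ht : 7 / 2 / Real.pi ^ 2 * (n ^ 2 * Real.log n) ≤ t) :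
    (Real.cos (2 * (Real.pi / n)) / Real.cos (Real.pi / n)) ^ t ≤ 1 / (n : ℝ) ^ 4 := by
  have hn' : (12 : ℝ) ≤ n := by exact_mod_cast hn
  have hn0 : (0 : ℝ) < n := by linarith
  have hpi := Real.pi_pos
  have hpi4 := Real.pi_lt_four
  have hlog : 0 ≤ Real.log n := Real.log_nonneg (by linarith)
  set θ := Real.pi / n with hθ
  have hnt : n * θ = Real.pi := by rw [hθ]; field_simp
  have hθ0 : 0 < θ := by positivity
  have hθ1 : θ ≤ 1 / 3 := by nlinarith
  have hcos : 0 < Real.cos θ := Real.cos_pos_of_mem_Ioo ⟨by linarith, by nlinarith⟩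
  have hcos2 : 0 < Real.cos (2 * θ) := Real.cos_pos_of_mem_Ioo ⟨by linarith, by nlinarith⟩
  have h1 : 6 / 5 * θ ^ 2 ≤ Real.cos θ - Real.cos (2 * θ) := by
    have hs := Real.sin_gt_sub_cube hθ0
    have hs' : 19 / 20 * θ ≤ Real.sin θ := by nlinarith [mul_pos hθ0 hθ0]
    have hc := Real.one_sub_sq_div_two_le_cos (x := θ)
    have hd : Real.cos (2 * θ) = 1 - 2 * Real.sin θ ^ 2 := by
      rw [Real.cos_two_mul, Real.cos_sq']; ring
    have : (19 / 20 * θ) ^ 2 ≤ Real.sin θ ^ 2 := by gcongr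
    nlinarith [sq_nonneg θ]
  have h2 : Real.cos (2 * θ) / Real.cos θ ≤ Real.exp (-(6 / 5 * θ ^ 2)) := by
    have : Real.cos (2 * θ) / Real.cos θ ≤ 1 - 6 / 5 * θ ^ 2 := by
      rw [div_le_iff₀ hcos]
      nlinarith [Real.cos_le_one θ, sq_nonneg θ]
    linarith [Real.add_one_le_exp (-(6 / 5 * θ ^ 2))]
  calc _ ≤ Real.exp (-(6 / 5 * θ ^ 2)) ^ t := by gcongr
    _ = Real.exp (-(6 / 5 * (θ ^ 2 * t))) := by rw [← Real.exp_nat_mul]; ring_nf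
    _ ≤ Real.exp (-(4 * Real.log n)) := by
      have : 7 / 2 * Real.log n ≤ θ ^ 2 * t := by
        calc 7 / 2 * Real.log n = θ ^ 2 * (7 / 2 / Real.pi ^ 2 * (n ^ 2 * Real.log n)) := by
              rw [hθ]; field_simp
          _ ≤ _ := by gcongr
      exact Real.exp_le_exp.2 (by linarith)
    _ = _ := by
      rw [Real.exp_neg, mul_comm, Real.exp_mul, Real.exp_log hn0]
      norm_num

theorem abs_cot_sub_le {n : ℕ} (hn : 10 ≤ n) :
    |2 / n * (Real.cos (Real.pi / n / 2) / Real.sin (Real.pi / n / 2)) - 4 / Real.pi| ≤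
      2 / (n : ℝ) ^ 2 := by
  have hn' : (10 : ℝ) ≤ n := by exact_mod_cast hn
  have hn0 : (0 : ℝ) < n := by linarith
  have hpi := Real.pi_pos
  have hpi4 := Real.pi_lt_four
  set x := Real.pi / n / 2 with hx
  have hx0 : 0 < x := by positivity
  have hnx : n * x = Real.pi / 2 := by rw [hx]; field_simp
  have hx1 : x < Real.pi / 2 := by nlinarith
  have hs : 0 < Real.sin x := Real.sin_pos_of_pos_of_lt_pi hx0 (by linarith)
  have hc : 0 < Real.cos x := Real.cos_pos_of_mem_Ioo ⟨by linarith, hx1⟩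
  have hup : x * Real.cos x / Real.sin x ≤ 1 := by
    rw [div_le_one hs]
    have := Real.le_tan hx0.le hx1
    rwa [Real.tan_eq_sin_div_cos, le_div_iff₀ hc] at this
  have hlo : 1 - x ^ 2 / 2 ≤ x * Real.cos x / Real.sin x := by
    refine (Real.one_sub_sq_div_two_le_cos (x := x)).trans ?_
    rw [le_div_iff₀ hs, mul_comm]
    gcongr
    exact Real.sin_le hx0.le
  have e : 2 / n * (Real.cos x / Real.sin x) = 4 / Real.pi * (x * Real.cos x / Real.sin x) := by
    rw [hx]; field_simp; ring
  have e2 : 4 / Real.pi * (x ^ 2 / 2) = Real.pi / 2 / n ^ 2 := by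
    rw [hx]; field_simp; ring
  have h4 : Real.pi / 2 / (n : ℝ) ^ 2 ≤ 2 / (n : ℝ) ^ 2 := by gcongr; linarith
  rw [e, abs_le]
  have hp : 0 < 4 / Real.pi := by positivity
  have h5 : 0 ≤ 2 / (n : ℝ) ^ 2 := by positivity
  constructor <;> nlinarith

end Trigonometry

section Survival

variable {Ω : Type*} [MeasurableSpace Ω] {P : ℤ → Measure Ω} {S : ℕ → Ω → ℤ}

theorem IsSRW.setIntegral_sin (hS : IsSRW P S) {n a : ℕ} (ha : 0 < a) (han : a < n) (k : ℕ)
    (t : ℕ) :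
    ∫ ω in {ω | ∀ s ≤ t, S s ω ∉ ({0, (n : ℤ)} : Set ℤ)},
      Real.sin (k * (Real.pi / n) * (S t ω : ℝ)) ∂(P a) =
    Real.cos (k * (Real.pi / n)) ^ t * Real.sin (k * (Real.pi / n) * a) := by
  have hn : (n : ℝ) ≠ 0 := by
    have : n ≠ 0 := by omega
    exact_mod_cast this
  have hmem : (a : ℤ) ∈ ({0, (n : ℤ)} : Set ℤ)ᶜ := by
    simp only [Set.mem_compl_iff, Set.mem_insert_iff, Set.mem_singleton_iff]
    omega
  have h := hS.setIntegral_eigen hmem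
    (h := fun y => Real.sin (k * (Real.pi / n) * (y : ℝ)))
    (fun y => Real.abs_sin_le_one _) ?_ (c := Real.cos (k * (Real.pi / n))) ?_ t
  · simpa using h
  · intro y hy
    simp only [Set.mem_compl_iff, Set.mem_insert_iff, Set.mem_singleton_iff, not_not] at hy
    rcases hy with rfl | rfl
    · simp
    · have : (k : ℝ) * (Real.pi / n) * ((n : ℤ) : ℝ) = k * Real.pi := by
        push_cast; field_simp
      rw [this, Real.sin_nat_mul_pi]
  · intro y
    push_cast
    rw [mul_add, mul_sub, mul_one, Real.sin_add, Real.sin_sub]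
    ring

/-- Spectral formula for the survival probability. -/
theorem IsSRW.survival_eq (hS : IsSRW P S) {n a : ℕ} (ha : 0 < a) (han : a < n) (t : ℕ) :
    n * (P a).real {ω | ∀ s ≤ t, S s ω ∉ ({0, (n : ℤ)} : Set ℤ)} =
    ∑ j ∈ range n, Real.cos ((2 * j + 1) * (Real.pi / n) / 2) /
      Real.sin ((2 * j + 1) * (Real.pi / n) / 2) *
      (Real.cos ((2 * j + 1) * (Real.pi / n)) ^ t *
        Real.sin ((2 * j + 1) * (Real.pi / n) * a)) := by
  have := hS.1 a
  set A := {ω | ∀ s ≤ t, S s ω ∉ ({0, (n : ℤ)} : Set ℤ)} with hA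
  have hAm : MeasurableSet A := by
    have : A = ⋂ s, ⋂ (_ : s ≤ t), S s ⁻¹' ({0, (n : ℤ)} : Set ℤ)ᶜ := by ext; simp [hA]
    rw [this]
    exact .iInter fun s => .iInter fun _ => hS.2.1 s (Set.to_countable _).measurableSet
  have h1 : n * (P a).real A = ∫ ω in A, (n : ℝ) ∂(P a) := by
    rw [setIntegral_const, smul_eq_mul, mul_comm]
  have h2 : ∫ ω in A, (n : ℝ) ∂(P a) = ∫ ω in A, ∑ j ∈ range n,
      Real.cos ((2 * j + 1) * (Real.pi / n) / 2) / Real.sin ((2 * j + 1) * (Real.pi / n) / 2) *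
        Real.sin ((2 * j + 1) * (Real.pi / n) * (S t ω : ℝ)) ∂(P a) := by
    refine setIntegral_congr_ae hAm ?_
    filter_upwards [hS.ae_mem_Ioo (x := a) (n := n) ⟨by omega, by omega⟩ t] with ω hω hωA
    obtain ⟨h0, hn⟩ := hω hωA
    obtain ⟨m, hm⟩ := Int.eq_ofNat_of_zero_le h0.le
    rw [hm] at h0 hn ⊢
    exact (sum_cot_mul_sin (by omega) (by omega)).symm
  rw [h1, h2, integral_finsetSum]
  · refine sum_congr rfl fun j _ => ?_
    rw [integral_const_mul]
    have := hS.setIntegral_sin ha han (2 * j + 1) t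
    push_cast at this
    rw [this]
  · intro j _
    exact (integrable_comp_of_abs_le_one (g := S t)
      (h := fun y => Real.sin ((2 * j + 1) * (Real.pi / n) * (y : ℝ)))
      (fun y => Real.abs_sin_le_one _) (hS.2.1 t)).const_mul _

theorem IsSRW.abs_cond_sin_sub_le (hS : IsSRW P S) {n a t : ℕ} (hn : 12 ≤ n) (ha : 0 < a)
    (han : a < n) (ht : 7 / 2 / Real.pi ^ 2 * (n ^ 2 * Real.log n) ≤ t) :
    |(∫ ω, Real.sin (Real.pi * (S t ω : ℝ) / n)
          ∂(ProbabilityTheory.cond (P a) {ω | ∀ s ≤ t, S s ω ∉ ({0, (n : ℤ)} : Set ℤ)}))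
        - Real.pi / 4| ≤ 12 / (n : ℝ) ^ 2 := by
  have hn' : (12 : ℝ) ≤ n := by exact_mod_cast hn
  have hn0 : (0 : ℝ) < n := by linarith
  have hpi := Real.pi_pos
  have hpi4 := Real.pi_lt_four
  have hpi3 := Real.pi_lt_d2
  have hsurv := hS.survival_eq ha han t
  have hmodes := abs_sum_modes_sub_le (t := t) (by omega : 10 ≤ n) ha han
  rw [← hsurv] at hmodes
  have hpow := cos_two_mul_div_cos_pow_le hn ht
  have hcot := abs_cot_sub_le (by omega : 10 ≤ n)
  have hnum := hS.setIntegral_sin ha han 1 t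
  simp only [Nat.cast_one, one_mul] at hnum
  set A := {ω | ∀ s ≤ t, S s ω ∉ ({0, (n : ℤ)} : Set ℤ)} with hA
  set p := (P a).real A with hp
  set M := Real.cos (Real.pi / n / 2) / Real.sin (Real.pi / n / 2)
  set R := (Real.cos (2 * (Real.pi / n)) / Real.cos (Real.pi / n)) ^ t
  have hB : 0 < Real.cos (Real.pi / n) ^ t * Real.sin (Real.pi / n * a) := by
    have hnt : n * (Real.pi / n) = Real.pi := by field_simp
    have ht0 : 0 < Real.pi / n := by positivity
    have hcos : 0 < Real.cos (Real.pi / n) :=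
      Real.cos_pos_of_mem_Ioo ⟨by linarith, by nlinarith⟩
    have ha0 : (0 : ℝ) < a := by exact_mod_cast ha
    have han' : (a : ℝ) < n := by exact_mod_cast han
    have hsin : 0 < Real.sin (Real.pi / n * a) :=
      Real.sin_pos_of_pos_of_lt_pi (by positivity) (by nlinarith)
    positivity
  set B := Real.cos (Real.pi / n) ^ t * Real.sin (Real.pi / n * a)
  have hcond : ∫ ω, Real.sin (Real.pi * (S t ω : ℝ) / n) ∂(ProbabilityTheory.cond (P a) A) =
      p⁻¹ * B := by
    rw [ProbabilityTheory.cond, integral_smul_measure, ← hnum, smul_eq_mul, ENNReal.toReal_inv]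
    congr 1
    refine integral_congr_ae (Eventually.of_forall fun ω => ?_)
    simp only
    congr 1
    ring
  rw [hcond]
  obtain ⟨Q, hQ⟩ : ∃ Q, p = B * Q := ⟨p / B, by field_simp⟩
  have hQ1 : |Q - 2 / n * M| ≤ 10 / (n : ℝ) ^ 2 := by
    have e : n * p - B * (2 * M) = B * (n * (Q - 2 / n * M)) := by
      rw [hQ]; field_simp
    rw [e, abs_mul, abs_of_pos hB, abs_mul, abs_of_pos hn0] at hmodes
    have h := le_of_mul_le_mul_left hmodes hB
    have h2 : 2 * (n : ℝ) ^ 3 * R ≤ 2 / (n : ℝ) := by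
      calc 2 * (n : ℝ) ^ 3 * R ≤ 2 * (n : ℝ) ^ 3 * (1 / (n : ℝ) ^ 4) := by gcongr
        _ = 2 / (n : ℝ) := by field_simp
    have h3 : n * |Q - 2 / n * M| ≤ 10 / n := by
      have : (10 : ℝ) / n = 8 / n + 2 / n := by ring
      linarith
    rw [le_div_iff₀ (by positivity)]
    rw [le_div_iff₀ hn0] at h3
    linarith
  have hQ2 : |Q - 4 / Real.pi| ≤ 12 / (n : ℝ) ^ 2 := by
    calc _ ≤ |Q - 2 / n * M| + |2 / n * M - 4 / Real.pi| := abs_sub_le _ _ _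
      _ ≤ 10 / (n : ℝ) ^ 2 + 2 / (n : ℝ) ^ 2 := add_le_add hQ1 hcot
      _ = _ := by ring
  have hQ3 : 1 ≤ Q := by
    have h1 : 12 / (n : ℝ) ^ 2 ≤ 1 / 12 := by
      rw [div_le_div_iff₀ (by positivity) (by norm_num)]
      nlinarith
    have h2 : 13 / 12 ≤ 4 / Real.pi := by
      rw [le_div_iff₀ hpi]; linarith
    linarith [(abs_le.1 hQ2).1]
  have hQ0 : 0 < Q := by linarith
  have e : p⁻¹ * B - Real.pi / 4 = -((Real.pi / 4) * (Q⁻¹ * (Q - 4 / Real.pi))) := by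
    rw [hQ]; field_simp; ring
  rw [e, abs_neg, abs_mul, abs_mul, abs_of_pos (by positivity : 0 < Real.pi / 4),
    abs_of_pos (inv_pos.2 hQ0)]
  calc _ ≤ 1 * (1 * |Q - 4 / Real.pi|) := by
        gcongr
        · linarith
        · exact inv_le_one_of_one_le₀ hQ3
    _ ≤ _ := by simpa using hQ2

end Survival

/-- if `Δ = Δ(n)` satisfies `liminf Δ/(n² ln n) ≥ 4/π²`, then,
uniformly in `1 ≤ a ≤ n - 1`,
`E_a[sin(π S_Δ / n) ∣ τ_{{0,n}} > Δ] = (1 + O(n⁻²)) π/4`. -/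
theorem srw_conditioned_sine_expectation
    {Ω : Type*} [MeasurableSpace Ω] (P : ℤ → Measure Ω) (S : ℕ → Ω → ℤ)
    (hS : IsSRW P S) (Δ : ℕ → ℕ)
    (hΔ : 4 / Real.pi ^ 2
      ≤ Filter.liminf (fun n : ℕ => (Δ n : ℝ) / ((n : ℝ) ^ 2 * Real.log n)) atTop) :
    ∃ C > (0 : ℝ), ∃ n₀ : ℕ, ∀ n ≥ n₀, ∀ a : ℤ, 1 ≤ a → a ≤ (n : ℤ) - 1 →
      |(∫ ω, Real.sin (Real.pi * (S (Δ n) ω : ℝ) / n)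
          ∂(ProbabilityTheory.cond (P a)
              {ω | ∀ s ≤ Δ n, S s ω ∉ ({0, (n : ℤ)} : Set ℤ)}))
        - Real.pi / 4|
      ≤ C / (n : ℝ) ^ 2 := by
  have hpi := Real.pi_pos
  have hlt : 7 / 2 / Real.pi ^ 2 <
      liminf (fun n : ℕ => (Δ n : ℝ) / ((n : ℝ) ^ 2 * Real.log n)) atTop :=
    lt_of_lt_of_le (by gcongr; norm_num) hΔ
  have hbdd : IsBoundedUnder (· ≥ ·) atTop
      (fun n : ℕ => (Δ n : ℝ) / ((n : ℝ) ^ 2 * Real.log n)) :=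
    isBoundedUnder_of ⟨0, fun n => by
      have := Real.log_natCast_nonneg n
      positivity⟩
  obtain ⟨N, hN⟩ := eventually_atTop.1 (eventually_lt_of_lt_liminf hlt hbdd)
  refine ⟨12, by norm_num, max N 12, fun n hn a ha han => ?_⟩
  have hn12 : 12 ≤ n := (le_max_right _ _).trans hn
  have hlog : 0 < Real.log n := Real.log_pos (by exact_mod_cast (show 1 < n by omega))
  have hn0 : (0 : ℝ) < n := by exact_mod_cast (show 0 < n by omega)
  have h := hN n ((le_max_left _ _).trans hn)
  rw [lt_div_iff₀ (by positivity)] at h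
  lift a to ℕ using by omega
  exact hS.abs_cond_sin_sub_le hn12 (by omega) (by omega) h.le
end
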